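/- arXiv:1503.04428 — 2 statements merged into one kernel-verified Lean document; each statement's English description precedes it below -/
import Mathlib

section
/- Let L be a positive definite, integral, strongly square free, totally-reflective ℤ-lattice of rank 3 with det L = q₁⋯q_s, where q₁ < q₂ < … < q_s are primes (necessarily s ≤ 9). Then, whenever the respective index is ≤ s: q₁ ≤ 89, q₂ ≤ 257, q₃ ≤ 733, q₄ ≤ 1063, q₅ ≤ 1033, q₆ ≤ 607, q₇ ≤ 293, q₈ ≤ 113, q₉ ≤ 37. -/
open Matrix

/-- The bilinear form attached to a Gram matrix `G` on `ℤ^m`. -/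
def Bf {m : ℕ} (G : Matrix (Fin m) (Fin m) ℤ) (x y : Fin m → ℤ) : ℤ :=
  x ⬝ᵥ G.mulVec y

/-- A vector of the lattice `ℤ^m` is primitive if it is not a proper multiple of a lattice
vector. -/
def PrimVec {m : ℕ} (v : Fin m → ℤ) : Prop :=
  ∀ c : ℤ, 1 < c → ¬∃ w : Fin m → ℤ, c • w = v

/-- `v` is a root of the lattice `(ℤ^m, G)`: it is nonzero, primitive, and the associated
reflection `x ↦ x − (2·b(x,v)/b(v,v))·v` maps the lattice into itself. -/
def IsRootM {m : ℕ} (G : Matrix (Fin m) (Fin m) ℤ) (v : Fin m → ℤ) : Prop :=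
  v ≠ 0 ∧ PrimVec v ∧
    ∀ x : Fin m → ℤ, ∃ y : Fin m → ℤ, ∀ i,
      (y i : ℚ) = (x i : ℚ) - 2 * (Bf G x v : ℚ) / (Bf G v v : ℚ) * (v i : ℚ)

/-- The lattice `(ℤ^m, G)` is reflective if its roots span a sublattice of full rank. -/
def ReflectiveM {m : ℕ} (G : Matrix (Fin m) (Fin m) ℤ) : Prop :=
  Module.finrank ℤ (Submodule.span ℤ {v : Fin m → ℤ | IsRootM G v}) = m

/-- Positive definiteness of the Gram matrix `G`. -/
def PosDefM {m : ℕ} (G : Matrix (Fin m) (Fin m) ℤ) : Prop :=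
  ∀ v : Fin m → ℤ, v ≠ 0 → 0 < Bf G v v

/-- Two integral lattices, given by Gram matrices, are in the same genus if the Gram
matrices are congruent over the ring `ℤ_p` of `p`-adic integers for every prime `p`. -/
def SameGenusM {m : ℕ} (G₁ G₂ : Matrix (Fin m) (Fin m) ℤ) : Prop :=
  ∀ (p : ℕ) [Fact p.Prime],
    ∃ S : Matrix (Fin m) (Fin m) ℤ_[p], IsUnit S.det ∧
      Sᵀ * G₁.map (Int.cast : ℤ → ℤ_[p]) * S = G₂.map (Int.cast : ℤ → ℤ_[p])

/-- The lattice `(ℤ^m, G)` is totally-reflective if every lattice in its genus is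
reflective. -/
def TotallyReflectiveM {m : ℕ} (G : Matrix (Fin m) (Fin m) ℤ) : Prop :=
  ∀ G' : Matrix (Fin m) (Fin m) ℤ, G'.IsSymm → PosDefM G' → SameGenusM G G' → ReflectiveM G'

/-- The lattice `(ℤ^m, G)` is square free: all elementary divisors of `G` are square free. -/
def SquareFreeM {m : ℕ} (G : Matrix (Fin m) (Fin m) ℤ) : Prop :=
  ∃ (S T : Matrix (Fin m) (Fin m) ℤ) (d : Fin m → ℤ),
    IsUnit S.det ∧ IsUnit T.det ∧ S * G * T = Matrix.diagonal d ∧ ∀ i, Squarefree (d i)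

/-- Strongly square free: square free and `v_p(det) ≤ m/2` for every prime `p`. -/
def StronglySquareFreeM {m : ℕ} (G : Matrix (Fin m) (Fin m) ℤ) : Prop :=
  SquareFreeM G ∧ ∀ p : ℕ, p.Prime → (G.det.natAbs).factorization p ≤ m / 2


theorem bf_add_left (G : Matrix (Fin 3) (Fin 3) ℤ) (x y z : Fin 3 → ℤ) :
    Bf G (x + y) z = Bf G x z + Bf G y z := by
  simp [Bf, add_dotProduct]

theorem bf_add_right (G : Matrix (Fin 3) (Fin 3) ℤ) (x y z : Fin 3 → ℤ) :
    Bf G x (y + z) = Bf G x y + Bf G x z := by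
  simp [Bf, Matrix.mulVec_add]

theorem bf_sub_left (G : Matrix (Fin 3) (Fin 3) ℤ) (x y z : Fin 3 → ℤ) :
    Bf G (x - y) z = Bf G x z - Bf G y z := by
  simp [Bf, sub_dotProduct]

theorem bf_sub_right (G : Matrix (Fin 3) (Fin 3) ℤ) (x y z : Fin 3 → ℤ) :
    Bf G x (y - z) = Bf G x y - Bf G x z := by
  simp [Bf, Matrix.mulVec_sub]

theorem bf_smul_left (G : Matrix (Fin 3) (Fin 3) ℤ) (a : ℤ) (x z : Fin 3 → ℤ) :
    Bf G (a • x) z = a * Bf G x z := by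
  simp only [Bf, smul_dotProduct, smul_eq_mul]

theorem bf_smul_right (G : Matrix (Fin 3) (Fin 3) ℤ) (a : ℤ) (x z : Fin 3 → ℤ) :
    Bf G x (a • z) = a * Bf G x z := by
  simp only [Bf, Matrix.mulVec_smul, dotProduct_smul, smul_eq_mul]

theorem bf_comm {G : Matrix (Fin 3) (Fin 3) ℤ} (hs : G.IsSymm) (x y : Fin 3 → ℤ) :
    Bf G x y = Bf G y x := by
  have h1 : G 1 0 = G 0 1 := hs.apply 0 1
  have h2 : G 2 0 = G 0 2 := hs.apply 0 2
  have h3 : G 2 1 = G 1 2 := hs.apply 1 2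
  simp only [Bf, dotProduct, Matrix.mulVec, Fin.sum_univ_three, h1, h2, h3]
  ring

theorem bf_nonneg {G : Matrix (Fin 3) (Fin 3) ℤ} (hp : PosDefM G) (x : Fin 3 → ℤ) :
    0 ≤ Bf G x x := by
  by_cases h : x = 0
  · subst h; simp [Bf]
  · exact (hp x h).le

theorem prim_bezout {r : Fin 3 → ℤ} (h0 : r ≠ 0) (hp : PrimVec r) :
    ∃ s : Fin 3 → ℤ, s 0 * r 0 + s 1 * r 1 + s 2 * r 2 = 1 := by
  set d1 : ℤ := (Int.gcd (r 0) (r 1) : ℤ) with hd1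
  set d : ℤ := (Int.gcd d1 (r 2) : ℤ) with hd
  have e1 := Int.gcd_eq_gcd_ab (r 0) (r 1)
  have e2 := Int.gcd_eq_gcd_ab d1 (r 2)
  rw [← hd1] at e1
  rw [← hd] at e2
  have k1 : d ∣ r 0 := (Int.gcd_dvd_left _ _).trans (Int.gcd_dvd_left _ _)
  have k2 : d ∣ r 1 := (Int.gcd_dvd_left _ _).trans (Int.gcd_dvd_right _ _)
  have k3 : d ∣ r 2 := Int.gcd_dvd_right _ _
  have hdn : 0 ≤ d := by positivity
  have hd1 : d = 1 := by
    rcases lt_trichotomy d 1 with h | h | h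
    · exfalso
      have : d = 0 := by omega
      rw [this] at k1 k2 k3
      apply h0
      ext i
      fin_cases i
      · simpa using k1
      · simpa using k2
      · simpa using k3
    · exact h
    · exfalso
      obtain ⟨a, ha⟩ := k1
      obtain ⟨b, hb⟩ := k2
      obtain ⟨c, hc⟩ := k3
      apply hp d h
      refine ⟨![a, b, c], ?_⟩
      ext i
      fin_cases i
      · simp [ha]
      · simp [hb]
      · simp [hc]
  refine ⟨![Int.gcdA d1 (r 2) * Int.gcdA (r 0) (r 1), Int.gcdA d1 (r 2) * Int.gcdB (r 0) (r 1),
    Int.gcdB d1 (r 2)], ?_⟩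
  simp
  rw [hd1] at e2
  linear_combination (-1 : ℤ) * e2 - Int.gcdA d1 (r 2) * e1

/-- A vector whose pairing with the lattice is divisible by `g` and whose norm is `g` or `2g`. -/
structure Semi (G : Matrix (Fin 3) (Fin 3) ℤ) (w : Fin 3 → ℤ) (g : ℤ) : Prop where
  pos : 0 < g
  dv : ∀ x, g ∣ Bf G x w
  nrm : Bf G w w = g ∨ Bf G w w = 2 * g
  gD : g ∣ G.det

theorem root_good {G : Matrix (Fin 3) (Fin 3) ℤ} (hp : PosDefM G)
    {r : Fin 3 → ℤ} (hr : IsRootM G r) :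
    ∃ c, Semi G r c ∧ ∃ s : Fin 3 → ℤ, s 0 * r 0 + s 1 * r 1 + s 2 * r 2 = 1 := by
  obtain ⟨h0, hpr, href⟩ := hr
  obtain ⟨s, hs⟩ := prim_bezout h0 hpr
  have hN := hp r h0
  set N := Bf G r r with hNdef
  have key : ∀ x, N ∣ 2 * Bf G x r := by
    intro x
    obtain ⟨y, hy⟩ := href x
    have hz : ∀ i, N * (x i - y i) = 2 * Bf G x r * r i := by
      intro i
      have h1 := hy i
      have hN' : (N : ℚ) ≠ 0 := by exact_mod_cast hN.ne'
      have : (N : ℚ) * (x i - y i) = 2 * Bf G x r * r i := by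
        rw [h1]; field_simp; ring
      exact_mod_cast this
    refine ⟨s 0 * (x 0 - y 0) + s 1 * (x 1 - y 1) + s 2 * (x 2 - y 2), ?_⟩
    linear_combination (-s 0) * hz 0 - s 1 * hz 1 - s 2 * hz 2 - 2 * Bf G x r * hs
  have detdv : ∀ c, (∀ x, c ∣ Bf G x r) → c ∣ G.det := by
    intro c hc
    have ha : G.adjugate *ᵥ (G *ᵥ r) = G.det • r := by
      rw [Matrix.mulVec_mulVec, Matrix.adjugate_mul, Matrix.smul_mulVec, Matrix.one_mulVec]
    have hj : ∀ j, c ∣ (G *ᵥ r) j := by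
      intro j
      have := hc (Pi.single j 1)
      simpa [Bf] using this
    have hi : ∀ i, c ∣ G.det * r i := by
      intro i
      have h2 := congrFun ha i
      simp only [Pi.smul_apply, smul_eq_mul] at h2
      rw [← h2]
      simp only [Matrix.mulVec, dotProduct] at hj ⊢
      exact Finset.dvd_sum (fun j _ => (hj j).mul_left _)
    have : G.det = s 0 * (G.det * r 0) + s 1 * (G.det * r 1) + s 2 * (G.det * r 2) := by
      linear_combination (-G.det) * hs
    rw [this]
    exact dvd_add (dvd_add ((hi 0).mul_left _) ((hi 1).mul_left _)) ((hi 2).mul_left _)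
  by_cases hall : ∀ x, N ∣ Bf G x r
  · exact ⟨N, ⟨hN, hall, Or.inl rfl, detdv N hall⟩, s, hs⟩
  · rcases Int.even_or_odd' N with ⟨m, hm | hm⟩
    · have hdm : ∀ x, m ∣ Bf G x r := by
        intro x
        have := key x
        rw [hm] at this
        exact (mul_dvd_mul_iff_left (by norm_num : (2:ℤ) ≠ 0)).1 this
      exact ⟨m, ⟨by omega, hdm, Or.inr hm, detdv m hdm⟩, s, hs⟩
    · exfalso
      apply hall
      intro x
      have hc : IsCoprime N 2 := ⟨1, -m, by rw [hm]; ring⟩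
      exact hc.dvd_of_dvd_mul_left (key x)

theorem cauchy {G : Matrix (Fin 3) (Fin 3) ℤ} (hs : G.IsSymm) (hp : PosDefM G)
    (x y : Fin 3 → ℤ) : Bf G x y ^ 2 ≤ Bf G x x * Bf G y y := by
  by_cases h : x = 0
  · subst h; simp [Bf]
  · have hx := hp x h
    have h1 := bf_nonneg hp (Bf G x x • y - Bf G x y • x)
    simp only [bf_sub_left, bf_sub_right, bf_smul_left, bf_smul_right, bf_comm hs y x] at h1
    by_contra hcon
    push Not at hcon
    nlinarith

theorem cauchy_eq {G : Matrix (Fin 3) (Fin 3) ℤ} (hs : G.IsSymm) (hp : PosDefM G)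
    (x y : Fin 3 → ℤ) (h : Bf G x x * Bf G y y ≤ Bf G x y ^ 2) :
    Bf G x x • y = Bf G x y • x := by
  by_contra hne
  have h1 := hp (Bf G x x • y - Bf G x y • x) (sub_ne_zero.2 hne)
  simp only [bf_sub_left, bf_sub_right, bf_smul_left, bf_smul_right, bf_comm hs y x] at h1
  have := bf_nonneg hp x
  nlinarith

theorem bessel3 {G : Matrix (Fin 3) (Fin 3) ℤ} (hs : G.IsSymm) (hp : PosDefM G)
    (y r1 r2 r3 : Fin 3 → ℤ) (h1 : 0 < Bf G r1 r1) (h2 : 0 < Bf G r2 r2) (h3 : 0 < Bf G r3 r3)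
    (h12 : Bf G r1 r2 = 0) (h13 : Bf G r1 r3 = 0) (h23 : Bf G r2 r3 = 0) :
    Bf G y r1 ^ 2 * (Bf G r2 r2 * Bf G r3 r3) + Bf G y r2 ^ 2 * (Bf G r1 r1 * Bf G r3 r3)
      + Bf G y r3 ^ 2 * (Bf G r1 r1 * Bf G r2 r2)
      ≤ Bf G y y * (Bf G r1 r1 * Bf G r2 r2 * Bf G r3 r3) := by
  have h := bf_nonneg hp ((Bf G r1 r1 * Bf G r2 r2 * Bf G r3 r3) • y
    - (Bf G y r1 * Bf G r2 r2 * Bf G r3 r3) • r1 - (Bf G y r2 * Bf G r1 r1 * Bf G r3 r3) • r2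
    - (Bf G y r3 * Bf G r1 r1 * Bf G r2 r2) • r3)
  simp only [bf_sub_left, bf_sub_right, bf_smul_left, bf_smul_right, bf_comm hs r1 y,
    bf_comm hs r2 y, bf_comm hs r3 y, bf_comm hs r2 r1, bf_comm hs r3 r1, bf_comm hs r3 r2,
    h12, h13, h23] at h
  have hP : 0 < Bf G r1 r1 * Bf G r2 r2 * Bf G r3 r3 := by positivity
  generalize Bf G r1 r1 = n1 at *
  generalize Bf G r2 r2 = n2 at *
  generalize Bf G r3 r3 = n3 at *
  generalize Bf G y r1 = b1 at *
  generalize Bf G y r2 = b2 at *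
  generalize Bf G y r3 = b3 at *
  generalize Bf G y y = n at *
  have : 0 ≤ (n1 * n2 * n3) * (n * (n1 * n2 * n3) - (b1 ^ 2 * (n2 * n3) + b2 ^ 2 * (n1 * n3)
      + b3 ^ 2 * (n1 * n2))) := by
    linarith
  have := nonneg_of_mul_nonneg_right this hP
  linarith

theorem bessel2 {G : Matrix (Fin 3) (Fin 3) ℤ} (hs : G.IsSymm) (hp : PosDefM G)
    (y r1 r2 : Fin 3 → ℤ) (h1 : 0 < Bf G r1 r1) (h2 : 0 < Bf G r2 r2)
    (h12 : Bf G r1 r2 = 0) :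
    Bf G y r1 ^ 2 * Bf G r2 r2 + Bf G y r2 ^ 2 * Bf G r1 r1
      ≤ Bf G y y * (Bf G r1 r1 * Bf G r2 r2) := by
  have h := bf_nonneg hp ((Bf G r1 r1 * Bf G r2 r2) • y
    - (Bf G y r1 * Bf G r2 r2) • r1 - (Bf G y r2 * Bf G r1 r1) • r2)
  simp only [bf_sub_left, bf_sub_right, bf_smul_left, bf_smul_right, bf_comm hs r1 y,
    bf_comm hs r2 y, bf_comm hs r2 r1, h12] at h
  have hP : 0 < Bf G r1 r1 * Bf G r2 r2 := by positivity
  generalize Bf G r1 r1 = n1 at *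
  generalize Bf G r2 r2 = n2 at *
  generalize Bf G y r1 = b1 at *
  generalize Bf G y r2 = b2 at *
  generalize Bf G y y = n at *
  have : 0 ≤ (n1 * n2) * (n * (n1 * n2) - (b1 ^ 2 * n2 + b2 ^ 2 * n1)) := by
    linarith
  have := nonneg_of_mul_nonneg_right this hP
  linarith

theorem gram_det {G : Matrix (Fin 3) (Fin 3) ℤ} (hs : G.IsSymm) (r : Fin 3 → Fin 3 → ℤ) :
    G.det * (Matrix.of r).det ^ 2 =
      Bf G (r 0) (r 0) * Bf G (r 1) (r 1) * Bf G (r 2) (r 2)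
      + 2 * Bf G (r 0) (r 1) * Bf G (r 0) (r 2) * Bf G (r 1) (r 2)
      - Bf G (r 0) (r 0) * Bf G (r 1) (r 2) ^ 2 - Bf G (r 1) (r 1) * Bf G (r 0) (r 2) ^ 2
      - Bf G (r 2) (r 2) * Bf G (r 0) (r 1) ^ 2 := by
  have h : ((Matrix.of r) * G * (Matrix.of r)ᵀ).det = G.det * (Matrix.of r).det ^ 2 := by
    rw [Matrix.det_mul, Matrix.det_mul, Matrix.det_transpose]; ring
  have hent : ∀ i j, ((Matrix.of r) * G * (Matrix.of r)ᵀ) i j = Bf G (r i) (r j) := by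
    intro i j
    simp only [Bf, Matrix.mul_apply, dotProduct, Matrix.mulVec, Fin.sum_univ_three,
      Matrix.transpose_apply, Matrix.of_apply]
    ring
  rw [← h, Matrix.det_fin_three]
  simp only [hent, bf_comm hs (r 1) (r 0), bf_comm hs (r 2) (r 0), bf_comm hs (r 2) (r 1)]
  ring

theorem ker_cross {G : Matrix (Fin 3) (Fin 3) ℤ} (hs : G.IsSymm) {q : ℤ} (hq : Prime q)
    (hqD : ¬ q * q ∣ G.det) (u w : Fin 3 → ℤ) (hu : ∀ x, q ∣ Bf G x u)
    (hw : ∀ x, q ∣ Bf G x w) (i j : Fin 3) : q ∣ u i * w j - u j * w i := by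
  have h1 : G 1 0 = G 0 1 := hs.apply 0 1
  have h2 : G 2 0 = G 0 2 := hs.apply 0 2
  have h3 : G 2 1 = G 1 2 := hs.apply 1 2
  have hu' : ∀ j, q ∣ G j 0 * u 0 + G j 1 * u 1 + G j 2 * u 2 := by
    intro j
    have := hu (Pi.single j 1)
    rw [Bf, single_one_dotProduct] at this
    simpa [Matrix.mulVec, dotProduct, Fin.sum_univ_three] using this
  have hw' : ∀ j, q ∣ G j 0 * w 0 + G j 1 * w 1 + G j 2 * w 2 := by
    intro j
    have := hw (Pi.single j 1)
    rw [Bf, single_one_dotProduct] at this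
    simpa [Matrix.mulVec, dotProduct, Fin.sum_univ_three] using this
  obtain ⟨a0, ha0⟩ := hu' 0
  obtain ⟨a1, ha1⟩ := hu' 1
  obtain ⟨a2, ha2⟩ := hu' 2
  obtain ⟨c0, hc0⟩ := hw' 0
  obtain ⟨c1, hc1⟩ := hw' 1
  obtain ⟨c2, hc2⟩ := hw' 2
  have fin : ∀ k m : ℤ, G.det * k = q * q * m → q ∣ k := by
    intro k m hkm
    by_contra hk
    have hd : q * q ∣ G.det * k := ⟨m, hkm⟩
    have : q ^ 2 ∣ G.det * k := by rwa [pow_two]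
    have h4 := hq.pow_dvd_of_dvd_mul_right 2 hk this
    rw [pow_two] at h4
    exact hqD h4
  have e0 : q ∣ u 1 * w 2 - u 2 * w 1 := by
    apply fin _ (G 0 0 * (a1 * c2 - a2 * c1) + G 0 1 * (a2 * c0 - a0 * c2)
      + G 0 2 * (a0 * c1 - a1 * c0))
    have : q * q * (G 0 0 * (a1 * c2 - a2 * c1) + G 0 1 * (a2 * c0 - a0 * c2)
      + G 0 2 * (a0 * c1 - a1 * c0)) = G 0 0 * ((q * a1) * (q * c2) - (q * a2) * (q * c1)) +
      G 0 1 * ((q * a2) * (q * c0) - (q * a0) * (q * c2))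
      + G 0 2 * ((q * a0) * (q * c1) - (q * a1) * (q * c0)) := by ring
    rw [this, ← ha0, ← ha1, ← ha2, ← hc0, ← hc1, ← hc2, Matrix.det_fin_three, h1, h2, h3]
    ring
  have e1 : q ∣ u 2 * w 0 - u 0 * w 2 := by
    apply fin _ (G 1 0 * (a1 * c2 - a2 * c1) + G 1 1 * (a2 * c0 - a0 * c2)
      + G 1 2 * (a0 * c1 - a1 * c0))
    have : q * q * (G 1 0 * (a1 * c2 - a2 * c1) + G 1 1 * (a2 * c0 - a0 * c2)
      + G 1 2 * (a0 * c1 - a1 * c0)) = G 1 0 * ((q * a1) * (q * c2) - (q * a2) * (q * c1)) +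
      G 1 1 * ((q * a2) * (q * c0) - (q * a0) * (q * c2))
      + G 1 2 * ((q * a0) * (q * c1) - (q * a1) * (q * c0)) := by ring
    rw [this, ← ha0, ← ha1, ← ha2, ← hc0, ← hc1, ← hc2, Matrix.det_fin_three, h1, h2, h3]
    ring
  have e2 : q ∣ u 0 * w 1 - u 1 * w 0 := by
    apply fin _ (G 2 0 * (a1 * c2 - a2 * c1) + G 2 1 * (a2 * c0 - a0 * c2)
      + G 2 2 * (a0 * c1 - a1 * c0))
    have : q * q * (G 2 0 * (a1 * c2 - a2 * c1) + G 2 1 * (a2 * c0 - a0 * c2)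
      + G 2 2 * (a0 * c1 - a1 * c0)) = G 2 0 * ((q * a1) * (q * c2) - (q * a2) * (q * c1)) +
      G 2 1 * ((q * a2) * (q * c0) - (q * a0) * (q * c2))
      + G 2 2 * ((q * a0) * (q * c1) - (q * a1) * (q * c0)) := by ring
    rw [this, ← ha0, ← ha1, ← ha2, ← hc0, ← hc1, ← hc2, Matrix.det_fin_three, h1, h2, h3]
    ring
  have e0' : q ∣ u 2 * w 1 - u 1 * w 2 := by rw [← dvd_neg]; rwa [neg_sub]
  have e1' : q ∣ u 0 * w 2 - u 2 * w 0 := by rw [← dvd_neg]; rwa [neg_sub]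
  have e2' : q ∣ u 1 * w 0 - u 0 * w 1 := by rw [← dvd_neg]; rwa [neg_sub]
  fin_cases i <;> fin_cases j <;> simp <;> assumption

theorem cube_dvd {G : Matrix (Fin 3) (Fin 3) ℤ} (hs : G.IsSymm) {q : ℤ} (hq : Prime q)
    (hqD : ¬ q * q ∣ G.det) (u w : Fin 3 → ℤ) (hu : ∀ x, q ∣ Bf G x u)
    (hw : ∀ x, q ∣ Bf G x w) (hpu : ∃ s : Fin 3 → ℤ, s 0 * u 0 + s 1 * u 1 + s 2 * u 2 = 1) :
    q ^ 3 ∣ Bf G u u * Bf G w w - Bf G u w ^ 2 := by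
  obtain ⟨s, hs1⟩ := hpu
  have hk := ker_cross hs hq hqD u w hu hw
  set t := s 0 * w 0 + s 1 * w 1 + s 2 * w 2 with ht
  have hd : ∀ i, q ∣ w i - t * u i := by
    intro i
    have : w i - t * u i = s 0 * (u 0 * w i - u i * w 0) + s 1 * (u 1 * w i - u i * w 1)
      + s 2 * (u 2 * w i - u i * w 2) := by
      rw [ht]; linear_combination (-w i) * hs1
    rw [this]
    exact dvd_add (dvd_add ((hk _ _).mul_left _) ((hk _ _).mul_left _)) ((hk _ _).mul_left _)
  choose y hy using hd
  have hw2 : w = t • u + q • y := by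
    ext i
    have := hy i
    simp only [Pi.add_apply, Pi.smul_apply, smul_eq_mul]
    linarith
  obtain ⟨m, hm⟩ := hu y
  obtain ⟨n, hn⟩ := hu u
  rw [hw2]
  simp only [bf_add_left, bf_add_right, bf_smul_left, bf_smul_right, bf_comm hs u y, hm, hn]
  exact ⟨n * Bf G y y - q * m ^ 2, by ring⟩

theorem lcmform {g c b : ℤ} (hg : 0 < g) (hc : 0 < c) (h1 : g ∣ b) (h2 : c ∣ b) :
    ∃ h g1 c1 t : ℤ, 0 < h ∧ 0 < g1 ∧ 0 < c1 ∧ g = h * g1 ∧ c = h * c1 ∧ b = h * g1 * c1 * t ∧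
      IsCoprime g1 c1 := by
  have hpos : 0 < Int.gcd g c := Int.gcd_pos_of_ne_zero_left _ hg.ne'
  obtain ⟨g1, c1, hcop, hg1, hc1⟩ := Int.exists_gcd_one hpos
  set h : ℤ := (Int.gcd g c : ℤ) with hh
  have hhp : 0 < h := by rw [hh]; exact_mod_cast hpos
  have hcp : IsCoprime g1 c1 := Int.isCoprime_iff_gcd_eq_one.2 hcop
  obtain ⟨b1, hb1⟩ := (Dvd.intro_left g1 hg1.symm : h ∣ g).trans h1
  have k1 : g1 ∣ b1 := by
    rw [hg1, hb1, mul_comm g1 h] at h1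
    exact (mul_dvd_mul_iff_left hhp.ne').1 h1
  have k2 : c1 ∣ b1 := by
    rw [hc1, hb1, mul_comm c1 h] at h2
    exact (mul_dvd_mul_iff_left hhp.ne').1 h2
  obtain ⟨t, ht⟩ := hcp.mul_dvd k1 k2
  refine ⟨h, g1, c1, t, hhp, ?_, ?_, by rw [mul_comm]; exact hg1, by rw [mul_comm]; exact hc1, ?_, hcp⟩
  · exact pos_of_mul_pos_left (hg1 ▸ hg) hhp.le
  · exact pos_of_mul_pos_left (hc1 ▸ hc) hhp.le
  · rw [hb1, ht]; ring

theorem lemK {G : Matrix (Fin 3) (Fin 3) ℤ} (hs : G.IsSymm)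
    (hsf : Squarefree G.det) {q : ℤ} (hq : Prime q) (hq5 : 5 ≤ q)
    {u w : Fin 3 → ℤ} {c g : ℤ} (hu : Semi G u c) (hw : Semi G w g)
    (hpu : ∃ s : Fin 3 → ℤ, s 0 * u 0 + s 1 * u 1 + s 2 * u 2 = 1)
    (hqc : q ∣ c) (hqg : q ∣ g) : Bf G u u * Bf G w w ≤ Bf G u w ^ 2 := by
  by_contra hcon
  push Not at hcon
  have hnu : ∀ d, d ∣ G.det → ¬ q * q ∣ d := fun d hd h =>
    hq.not_isUnit (hsf q (h.trans hd))
  have h3 := cube_dvd hs hq (hnu _ dvd_rfl) u w (fun x => hqc.trans (hu.dv x))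
    (fun x => hqg.trans (hw.dv x)) hpu
  obtain ⟨h, c1, g1, t, hh, hc1, hg1, ec, eg, eb, hcop⟩ :=
    lcmform (b := Bf G u w) hu.pos hw.pos (by rw [bf_comm hs]; exact hu.dv w) (hw.dv u)
  have hqh : q ∣ h := by
    by_contra hn
    rw [ec] at hqc
    rw [eg] at hqg
    have k1 := (hq.dvd_or_dvd hqc).resolve_left hn
    have k2 := (hq.dvd_or_dvd hqg).resolve_left hn
    exact hq.not_isUnit (hcop.isUnit_of_dvd' k1 k2)
  obtain ⟨h', rfl⟩ := hqh
  have nh' : ¬ q ∣ h' := by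
    rintro ⟨m, rfl⟩
    exact hnu c hu.gD ⟨m * c1, by rw [ec]; ring⟩
  have nc1 : ¬ q ∣ c1 := by
    rintro ⟨m, rfl⟩
    exact hnu c hu.gD ⟨h' * m, by rw [ec]; ring⟩
  have ng1 : ¬ q ∣ g1 := by
    rintro ⟨m, rfl⟩
    exact hnu g hw.gD ⟨h' * m, by rw [eg]; ring⟩
  have main : ∀ j : ℤ, j ≤ 4 → Bf G u u * Bf G w w = j * (c * g) → False := by
    intro j hj hjj
    have e : Bf G u u * Bf G w w - Bf G u w ^ 2
        = q ^ 2 * (h' * (h' * (c1 * (g1 * (j - c1 * g1 * t ^ 2))))) := by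
      rw [hjj, eb, ec, eg]; ring
    rw [e] at h3
    have hd : q ∣ (h' * (h' * (c1 * (g1 * (j - c1 * g1 * t ^ 2))))) := by
      rw [pow_succ] at h3
      exact (mul_dvd_mul_iff_left (pow_ne_zero 2 hq.ne_zero)).1 h3
    have hd2 : q ∣ j - c1 * g1 * t ^ 2 := by
      have := (hq.dvd_or_dvd hd).resolve_left nh'
      have := (hq.dvd_or_dvd this).resolve_left nh'
      have := (hq.dvd_or_dvd this).resolve_left nc1
      exact (hq.dvd_or_dvd this).resolve_left ng1
    have hpos : 0 < j - c1 * g1 * t ^ 2 := by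
      by_contra hneg
      push Not at hneg
      have hposP : 0 ≤ q ^ 2 * (h' * h') * (c1 * g1) := by
        have : 0 ≤ h' * h' := mul_self_nonneg h'
        positivity
      have : q ^ 2 * (h' * (h' * (c1 * (g1 * (j - c1 * g1 * t ^ 2))))) ≤ 0 := by
        have := mul_nonpos_of_nonneg_of_nonpos hposP hneg
        linarith
      linarith
    have := Int.le_of_dvd hpos hd2
    have h0 : 0 ≤ c1 * g1 * t ^ 2 := by positivity
    linarith
  rcases hu.nrm with a | a <;> rcases hw.nrm with b | b
  · exact main 1 (by norm_num) (by rw [a, b]; ring)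
  · exact main 2 (by norm_num) (by rw [a, b]; ring)
  · exact main 2 (by norm_num) (by rw [a, b]; ring)
  · exact main 4 (by norm_num) (by rw [a, b]; ring)

theorem semi_pos {G : Matrix (Fin 3) (Fin 3) ℤ} {w : Fin 3 → ℤ} {g : ℤ} (h : Semi G w g) :
    0 < Bf G w w := by
  have := h.pos
  rcases h.nrm with a | a <;> rw [a] <;> linarith

theorem semi_two {G : Matrix (Fin 3) (Fin 3) ℤ} {w : Fin 3 → ℤ} {g : ℤ} (h : Semi G w g)
    (x : Fin 3 → ℤ) : Bf G w w ∣ 2 * Bf G x w := by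
  rcases h.nrm with a | a <;> rw [a]
  · exact (h.dv x).mul_left 2
  · exact mul_dvd_mul_left 2 (h.dv x)

theorem semi_prime {G : Matrix (Fin 3) (Fin 3) ℤ} {w : Fin 3 → ℤ} {g : ℤ} (h : Semi G w g)
    {q : ℤ} (hq : Prime q) (hq3 : 3 ≤ q) : q ∣ Bf G w w ↔ q ∣ g := by
  rcases h.nrm with a | a <;> rw [a]
  constructor
  · intro hd
    refine (hq.dvd_or_dvd hd).resolve_left (fun h2 => ?_)
    have := Int.le_of_dvd (by norm_num) h2
    linarith
  · intro hd; exact hd.mul_left 2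

theorem lemR {G : Matrix (Fin 3) (Fin 3) ℤ} (hs : G.IsSymm) (hp : PosDefM G)
    {q : ℤ} (hq : Prime q) (hq5 : 5 ≤ q)
    {u w : Fin 3 → ℤ} {c g : ℤ} (hu : Semi G u c) (hw : Semi G w g)
    (hb : Bf G u w ≠ 0) (hqc : q ∣ c) : q ∣ g := by
  obtain ⟨a, ha⟩ := semi_two hu w
  obtain ⟨a', ha'⟩ := semi_two hw u
  rw [bf_comm hs w u] at ha
  have h1 := semi_pos hu
  have h2 := semi_pos hw
  rw [← semi_prime hw hq (by linarith)]
  rw [← semi_prime hu hq (by linarith)] at hqc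
  have hcs := cauchy hs hp u w
  set n := Bf G u u
  set n' := Bf G w w
  have hd : q ∣ n' * a' := by rw [← ha', ha]; exact hqc.mul_right a
  refine (hq.dvd_or_dvd hd).resolve_right (fun h3 => ?_)
  have e : n * n' * (a * a') = 4 * Bf G u w ^ 2 := by
    have : n * n' * (a * a') = (n * a) * (n' * a') := by ring
    rw [this, ← ha, ← ha']; ring
  have hpos : 0 < n * n' * (a * a') := by rw [e]; positivity
  have hnn : 0 < n * n' := by positivity
  have haa : 0 < a * a' := pos_of_mul_pos_right hpos hnn.le
  have haa4 : a * a' ≤ 4 := by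
    by_contra hc
    push Not at hc
    nlinarith
  have := Int.le_of_dvd haa (h3.mul_left a)
  linarith

theorem lemE {G : Matrix (Fin 3) (Fin 3) ℤ} (hs : G.IsSymm) (hp : PosDefM G)
    {q : ℤ} (hq : Prime q) (hq5 : 5 ≤ q) (hqD : q ∣ G.det) (hD : 0 < G.det)
    (r : Fin 3 → Fin 3 → ℤ) (c : Fin 3 → ℤ) (hr : ∀ i, Semi G (r i) (c i))
    (hdet : (Matrix.of r).det ≠ 0) : ∃ i, q ∣ c i := by
  have hg := gram_det hs r
  have p0 := semi_pos (hr 0)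
  have p1 := semi_pos (hr 1)
  have p2 := semi_pos (hr 2)
  suffices h : ∃ i, q ∣ Bf G (r i) (r i) by
    obtain ⟨i, hi⟩ := h
    exact ⟨i, (semi_prime (hr i) hq (by linarith)).1 hi⟩
  obtain ⟨a01, h01⟩ := semi_two (hr 0) (r 1)
  obtain ⟨a02, h02⟩ := semi_two (hr 0) (r 2)
  obtain ⟨a10, h10⟩ := semi_two (hr 1) (r 0)
  obtain ⟨a12, h12⟩ := semi_two (hr 1) (r 2)
  obtain ⟨a20, h20⟩ := semi_two (hr 2) (r 0)
  obtain ⟨a21, h21⟩ := semi_two (hr 2) (r 1)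
  rw [bf_comm hs (r 1) (r 0)] at h01
  rw [bf_comm hs (r 2) (r 0)] at h02
  rw [bf_comm hs (r 2) (r 1)] at h12
  have cs := cauchy hs hp (r 0) (r 1)
  have hDR : 0 < G.det * (Matrix.of r).det ^ 2 := by positivity
  have hdv : q ∣ 4 * (G.det * (Matrix.of r).det ^ 2) := (hqD.mul_right _).mul_left _
  have fin : ∀ i, q ∣ Bf G (r i) (r i) → ∃ i, q ∣ Bf G (r i) (r i) := fun i h => ⟨i, h⟩
  have fin0 := fin 0
  have fin1 := fin 1
  have fin2 := fin 2
  clear fin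
  generalize (∃ i, q ∣ Bf G (r i) (r i)) = goal at *
  generalize Bf G (r 0) (r 0) = n0 at *
  generalize Bf G (r 1) (r 1) = n1 at *
  generalize Bf G (r 2) (r 2) = n2 at *
  generalize Bf G (r 0) (r 1) = b01 at *
  generalize Bf G (r 0) (r 2) = b02 at *
  generalize Bf G (r 1) (r 2) = b12 at *
  have hA : (a01 * a10) * (n0 * n1) = 4 * b01 ^ 2 := by
    linear_combination (-1:ℤ) * (n1 * a10) * h01 - 2 * b01 * h10
  have hB : (a02 * a20) * (n0 * n2) = 4 * b02 ^ 2 := by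
    linear_combination (-1:ℤ) * (n2 * a20) * h02 - 2 * b02 * h20
  have hC : (a12 * a21) * (n1 * n2) = 4 * b12 ^ 2 := by
    linear_combination (-1:ℤ) * (n2 * a21) * h12 - 2 * b12 * h21
  have hP1 : (a01 * a12 * a20) * (n0 * n1 * n2) = 8 * b01 * b02 * b12 := by
    have : (a01 * a12 * a20) * (n0 * n1 * n2) = (n0 * a01) * (n1 * a12) * (n2 * a20) := by ring
    rw [this, ← h01, ← h12, ← h20]; ring
  have hP2 : (a10 * a21 * a02) * (n0 * n1 * n2) = 8 * b01 * b02 * b12 := by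
    have : (a10 * a21 * a02) * (n0 * n1 * n2) = (n1 * a10) * (n2 * a21) * (n0 * a02) := by ring
    rw [this, ← h10, ← h21, ← h02]; ring
  have hPP : a01 * a12 * a20 = a10 * a21 * a02 :=
    mul_right_cancel₀ (by positivity) (hP1.trans hP2.symm)
  set A := a01 * a10 with hAd
  set B := a02 * a20 with hBd
  set C := a12 * a21 with hCd
  set P := a01 * a12 * a20 with hPd
  have hP3 : P ^ 2 = A * B * C := by
    rw [pow_two]; nth_rw 2 [hPP]; rw [hAd, hBd, hCd, hPd]; ring
  have posn : ∀ x k m : ℤ, 0 < k → x * k = 4 * m ^ 2 → 0 ≤ x := by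
    intro x k m hk hx
    exact nonneg_of_mul_nonneg_left (hx ▸ by positivity) hk
  have A0 := posn A _ _ (mul_pos p0 p1) hA
  have B0 := posn B _ _ (mul_pos p0 p2) hB
  have C0 := posn C _ _ (mul_pos p1 p2) hC
  have A4 : A ≤ 4 := by
    by_contra hc
    push Not at hc
    have := mul_pos p0 p1
    nlinarith
  have hPle : P ≤ B + C := by
    apply abs_le_of_sq_le_sq' _ (by linarith) |>.2
    have : 0 ≤ B * C := mul_nonneg B0 C0
    nlinarith [sq_nonneg (B - C)]
  have eX : 4 * (G.det * (Matrix.of r).det ^ 2) = n0 * n1 * n2 * (4 + P - A - B - C) := by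
    rw [hg]
    linear_combination (-1:ℤ) * hP1 + n2 * hA + n1 * hB + n0 * hC
  have hX : 0 < 4 + P - A - B - C := by
    apply pos_of_mul_pos_right (a := n0 * n1 * n2) _ (by positivity)
    rw [← eX]; positivity
  rw [eX] at hdv
  rcases hq.dvd_or_dvd hdv with h | h
  · rcases hq.dvd_or_dvd h with h | h
    · rcases hq.dvd_or_dvd h with h | h
      · exact fin0 h
      · exact fin1 h
    · exact fin2 h
  · have := Int.le_of_dvd hX h
    linarith

theorem span_lt {G : Matrix (Fin 3) (Fin 3) ℤ} (w : Fin 3 → ℤ) (hw : w ≠ 0)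
    (h : ∀ r, IsRootM G r → w 0 * r 0 + w 1 * r 1 + w 2 * r 2 = 0) : ¬ ReflectiveM G := by
  intro hr
  unfold ReflectiveM at hr
  let φ : (Fin 3 → ℤ) →ₗ[ℤ] ℤ := w 0 • LinearMap.proj 0 + w 1 • LinearMap.proj 1
    + w 2 • LinearMap.proj 2
  have hφ : ∀ x, φ x = w 0 * x 0 + w 1 * x 1 + w 2 * x 2 := fun x => by simp [φ]
  have hle : Submodule.span ℤ {v : Fin 3 → ℤ | IsRootM G v} ≤ LinearMap.ker φ := by
    rw [Submodule.span_le]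
    intro r hr'
    simp only [SetLike.mem_coe, LinearMap.mem_ker, hφ]
    exact h r hr'
  have h1 := Submodule.finrank_mono hle
  have h2 := Submodule.finrank_quotient_add_finrank (LinearMap.ker φ)
  rw [φ.quotKerEquivRange.finrank_eq] at h2
  have h3 : Module.finrank ℤ (Fin 3 → ℤ) = 3 := by simp
  have h4 : Module.finrank ℤ (LinearMap.range φ) = 0 := by omega
  rw [Submodule.finrank_eq_zero, LinearMap.range_eq_bot] at h4
  apply hw
  have h5 : φ w = 0 := by rw [h4]; rfl
  rw [hφ] at h5
  have s0 := mul_self_nonneg (w 0)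
  have s1 := mul_self_nonneg (w 1)
  have s2 := mul_self_nonneg (w 2)
  have t0 : w 0 = 0 := mul_self_eq_zero.1 (by linarith)
  have t1 : w 1 = 0 := mul_self_eq_zero.1 (by linarith)
  have t2 : w 2 = 0 := mul_self_eq_zero.1 (by linarith)
  ext i
  fin_cases i
  · exact t0
  · exact t1
  · exact t2

theorem three_roots {G : Matrix (Fin 3) (Fin 3) ℤ} (hr : ReflectiveM G) :
    ∃ r : Fin 3 → Fin 3 → ℤ, (∀ i, IsRootM G (r i)) ∧ (Matrix.of r).det ≠ 0 := by
  by_contra hcon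
  push Not at hcon
  by_cases h1 : ∃ a b, IsRootM G a ∧ IsRootM G b ∧
      (![a 1 * b 2 - a 2 * b 1, a 2 * b 0 - a 0 * b 2, a 0 * b 1 - a 1 * b 0] : Fin 3 → ℤ) ≠ 0
  · obtain ⟨a, b, ha, hb, hab⟩ := h1
    refine span_lt _ hab (fun r hr' => ?_) hr
    have := hcon ![a, b, r] (by intro i; fin_cases i <;> assumption)
    rw [Matrix.det_fin_three] at this
    simp at this ⊢
    linear_combination this
  · push Not at h1
    by_cases h2 : ∃ a, IsRootM G a
    · obtain ⟨a, ha⟩ := h2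
      have hx : ∀ r, IsRootM G r → a 1 * r 2 - a 2 * r 1 = 0 ∧ a 2 * r 0 - a 0 * r 2 = 0 ∧
          a 0 * r 1 - a 1 * r 0 = 0 := by
        intro r hr'
        have := h1 a r ha hr'
        exact ⟨congrFun this 0, congrFun this 1, congrFun this 2⟩
      by_cases h3 : a 0 = 0 ∧ a 1 = 0
      · have h4 : a 2 ≠ 0 := by
          intro h4
          apply ha.1
          ext i
          fin_cases i
          · exact h3.1
          · exact h3.2
          · exact h4
        refine span_lt ![1, 0, 0] (fun h => by simpa using congrFun h 0) (fun r hr' => ?_) hr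
        obtain ⟨_, e, _⟩ := hx r hr'
        rw [h3.1] at e
        simpa [h4] using e
      · refine span_lt ![- a 1, a 0, 0] (fun h => h3 ⟨?_, ?_⟩) (fun r hr' => ?_) hr
        · simpa using congrFun h 1
        · simpa using congrFun h 0
        · obtain ⟨_, _, e⟩ := hx r hr'
          simp
          linarith
    · push Not at h2
      exact span_lt ![1, 0, 0] (fun h => by simpa using congrFun h 0)
        (fun r hr' => absurd hr' (h2 r)) hr

theorem quad_coeffs {F : Type*} [Field F] (a b c : F)
    (h : Polynomial.C a + Polynomial.C b * Polynomial.X + Polynomial.C c * Polynomial.X ^ 2 = 0) :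
    a = 0 ∧ b = 0 ∧ c = 0 := by
  have c0 := congrArg (fun p => Polynomial.coeff p 0) h
  have c1 := congrArg (fun p => Polynomial.coeff p 1) h
  have c2 := congrArg (fun p => Polynomial.coeff p 2) h
  simp [Polynomial.coeff_C, Polynomial.coeff_X, Polynomial.coeff_X_pow] at c0 c1 c2
  exact ⟨c0, c1, c2⟩

theorem exists_isotropic (l : ℕ) [Fact l.Prime] (G : Matrix (Fin 3) (Fin 3) (ZMod l)) :
    ∃ v : Fin 3 → ZMod l, v ≠ 0 ∧ v ⬝ᵥ G *ᵥ v = 0 := by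
  classical
  let f : MvPolynomial (Fin 3) (ZMod l) :=
    ∑ i, ∑ j, MvPolynomial.C (G i j) * (MvPolynomial.X i * MvPolynomial.X j)
  have hf : f.totalDegree < Fintype.card (Fin 3) := by
    have : f.totalDegree ≤ 2 := by
      refine MvPolynomial.totalDegree_finsetSum_le (fun i _ => ?_)
      refine MvPolynomial.totalDegree_finsetSum_le (fun j _ => ?_)
      refine (MvPolynomial.totalDegree_mul _ _).trans ?_
      rw [MvPolynomial.totalDegree_C, zero_add]
      refine (MvPolynomial.totalDegree_mul _ _).trans ?_
      simp
    simp
    omega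
  have hev : ∀ v, MvPolynomial.eval v f = v ⬝ᵥ G *ᵥ v := by
    intro v
    simp only [f, map_add, map_mul, MvPolynomial.eval_C, MvPolynomial.eval_X, dotProduct,
      Matrix.mulVec, Fin.sum_univ_three]
    ring
  have hd := char_dvd_card_solutions l hf
  have h0 : 0 < Fintype.card {x : Fin 3 → ZMod l // MvPolynomial.eval x f = 0} :=
    Fintype.card_pos_iff.2 ⟨⟨0, by rw [hev]; simp⟩⟩
  have h1 : 1 < Fintype.card {x : Fin 3 → ZMod l // MvPolynomial.eval x f = 0} :=
    lt_of_lt_of_le (Fact.out : l.Prime).one_lt (Nat.le_of_dvd h0 hd)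
  obtain ⟨⟨a, ha⟩, ⟨b, hb⟩, hab⟩ := Fintype.one_lt_card_iff.1 h1
  rw [hev] at ha hb
  by_cases h : a = 0
  · refine ⟨b, ?_, hb⟩
    rintro rfl
    exact hab (by simp [h])
  · exact ⟨a, h, ha⟩

theorem isotropic_avoid (l : ℕ) [Fact l.Prime] (hl2 : (2 : ZMod l) ≠ 0)
    (G : Matrix (Fin 3) (Fin 3) (ZMod l)) (hs : G.IsSymm) (hD : G.det ≠ 0)
    (k : ℕ) (hk : 2 * k < l) (r : Fin k → Fin 3 → ZMod l) (hr : ∀ i, r i ≠ 0) :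
    ∃ v : Fin 3 → ZMod l, v ⬝ᵥ G *ᵥ v = 0 ∧ ∀ i, v ⬝ᵥ G *ᵥ (r i) ≠ 0 := by
  classical
  obtain ⟨v0, hv0, hiso⟩ := exists_isotropic l G
  have g1 : G 1 0 = G 0 1 := hs.apply 0 1
  have g2 : G 2 0 = G 0 2 := hs.apply 0 2
  have g3 : G 2 1 = G 1 2 := hs.apply 1 2
  have comm : ∀ x y : Fin 3 → ZMod l, x ⬝ᵥ G *ᵥ y = y ⬝ᵥ G *ᵥ x := by
    intro x y
    simp only [dotProduct, Matrix.mulVec, Fin.sum_univ_three, g1, g2, g3]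
    ring
  have hGv : G *ᵥ v0 ≠ 0 := by
    intro h
    exact hv0 (Matrix.eq_zero_of_mulVec_eq_zero hD h)
  obtain ⟨j, hj⟩ := Function.ne_iff.1 hGv
  simp only [Pi.zero_apply] at hj
  obtain ⟨u0, hu0⟩ : ∃ u0 : Fin 3 → ZMod l, u0 ⬝ᵥ G *ᵥ v0 = 1 := by
    refine ⟨((G *ᵥ v0) j)⁻¹ • Pi.single j 1, ?_⟩
    rw [smul_dotProduct, single_one_dotProduct, smul_eq_mul, inv_mul_cancel₀ hj]
  obtain ⟨u, hu1, hu2⟩ : ∃ u : Fin 3 → ZMod l, u ⬝ᵥ G *ᵥ v0 = 1 ∧ u ⬝ᵥ G *ᵥ u = 0 := by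
    refine ⟨u0 - ((u0 ⬝ᵥ G *ᵥ u0) * 2⁻¹) • v0, ?_, ?_⟩
    · rw [sub_dotProduct, smul_dotProduct, hu0, hiso]; simp
    · rw [Matrix.mulVec_sub, Matrix.mulVec_smul]
      simp only [sub_dotProduct, dotProduct_sub, smul_dotProduct, dotProduct_smul, hiso,
        comm v0 u0, hu0, smul_eq_mul]
      field_simp
      ring
  set z : Fin 3 → ZMod l := ![(G *ᵥ v0) 1 * (G *ᵥ u) 2 - (G *ᵥ v0) 2 * (G *ᵥ u) 1,
    (G *ᵥ v0) 2 * (G *ᵥ u) 0 - (G *ᵥ v0) 0 * (G *ᵥ u) 2,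
    (G *ᵥ v0) 0 * (G *ᵥ u) 1 - (G *ᵥ v0) 1 * (G *ᵥ u) 0] with hz
  have hzv : z ⬝ᵥ G *ᵥ v0 = 0 := by
    rw [dotProduct, Fin.sum_univ_three]
    simp only [hz, Matrix.cons_val_zero, Matrix.cons_val_one, Matrix.cons_val]
    ring
  have hzu : z ⬝ᵥ G *ᵥ u = 0 := by
    rw [dotProduct, Fin.sum_univ_three]
    simp only [hz, Matrix.cons_val_zero, Matrix.cons_val_one, Matrix.cons_val]
    ring
  have hvu : v0 ⬝ᵥ G *ᵥ u = 1 := by rw [comm, hu1]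
  set δ := z ⬝ᵥ G *ᵥ z with hδ
  set M : Matrix (Fin 3) (Fin 3) (ZMod l) := Matrix.of ![v0, u, z] with hM
  have hMdet : M.det = -1 := by
    have e1 := hvu
    have e2 := hu1
    have e3 := hiso
    have e4 := hu2
    rw [dotProduct, Fin.sum_univ_three] at e1 e2 e3 e4
    rw [Matrix.det_fin_three]
    simp only [hM, hz, Matrix.of_apply, Matrix.cons_val_zero, Matrix.cons_val_one, Matrix.cons_val]
    generalize (G *ᵥ v0) = p at *
    generalize (G *ᵥ u) = w at *
    linear_combination (u 0 * w 0 + u 1 * w 1 + u 2 * w 2) * e3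
      - (u 0 * p 0 + u 1 * p 1 + u 2 * p 2) * e1 - e2
  have hMG : ∀ i j, (M * G * Mᵀ) i j = (![v0, u, z] i) ⬝ᵥ G *ᵥ (![v0, u, z] j) := by
    intro i j
    simp only [hM, Matrix.mul_apply, dotProduct, Matrix.mulVec, Fin.sum_univ_three,
      Matrix.transpose_apply, Matrix.of_apply]
    ring
  have hδ0 : δ ≠ 0 := by
    have h1 : (M * G * Mᵀ).det = G.det := by
      rw [Matrix.det_mul, Matrix.det_mul, Matrix.det_transpose, hMdet]; ring
    rw [Matrix.det_fin_three] at h1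
    simp only [hMG, Matrix.cons_val_zero, Matrix.cons_val_one, Matrix.cons_val, hiso, hvu, hu1,
      hu2, hzv, hzu, comm v0 z, comm u z, ← hδ] at h1
    intro h
    apply hD
    rw [← h1, h]; ring
  let v : ZMod l → Fin 3 → ZMod l := fun t => v0 + t • z - (δ * t ^ 2 * 2⁻¹) • u
  have hvb : ∀ t x, v t ⬝ᵥ G *ᵥ x
      = v0 ⬝ᵥ G *ᵥ x + t * (z ⬝ᵥ G *ᵥ x) - δ * t ^ 2 * 2⁻¹ * (u ⬝ᵥ G *ᵥ x) := by
    intro t x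
    simp only [v, sub_dotProduct, add_dotProduct, smul_dotProduct, smul_eq_mul]
  have hviso : ∀ t, v t ⬝ᵥ G *ᵥ (v t) = 0 := by
    intro t
    rw [hvb, comm v0 (v t), comm z (v t), comm u (v t), hvb, hvb, hvb, hiso, hzv, hu1, hu2, hzu,
      hvu, comm v0 z, comm u z, hzv, hzu, ← hδ]
    field_simp
    ring
  let f : Fin k → Polynomial (ZMod l) := fun i =>
    Polynomial.C (v0 ⬝ᵥ G *ᵥ (r i)) + Polynomial.C (z ⬝ᵥ G *ᵥ (r i)) * Polynomial.X
      + Polynomial.C (- (δ * 2⁻¹ * (u ⬝ᵥ G *ᵥ (r i)))) * Polynomial.X ^ 2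
  have hfe : ∀ i t, (f i).eval t = v t ⬝ᵥ G *ᵥ (r i) := by
    intro i t
    simp only [f, hvb, Polynomial.eval_add, Polynomial.eval_mul, Polynomial.eval_C,
      Polynomial.eval_X, Polynomial.eval_pow]
    ring
  have hf0 : ∀ i, f i ≠ 0 := by
    intro i h
    obtain ⟨c0, c1, c2⟩ := quad_coeffs _ _ _ h
    have c2' : u ⬝ᵥ G *ᵥ (r i) = 0 := by
      rw [neg_eq_zero] at c2
      exact (mul_eq_zero.1 c2).resolve_left (mul_ne_zero hδ0 (inv_ne_zero hl2))
    apply hr i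
    have hMM : M *ᵥ (G *ᵥ (r i)) = 0 := by
      ext a
      fin_cases a
      · exact c0
      · exact c2'
      · exact c1
    have h2 := Matrix.eq_zero_of_mulVec_eq_zero (by rw [hMdet]; simp) hMM
    exact Matrix.eq_zero_of_mulVec_eq_zero hD h2
  have hfd : ∀ i, (f i).natDegree ≤ 2 := by
    intro i
    simp only [f]
    compute_degree
  have hP0 : (∏ i, f i) ≠ 0 := Finset.prod_ne_zero_iff.2 (fun i _ => hf0 i)
  have hPd : (∏ i, f i).natDegree ≤ 2 * k := by
    refine (Polynomial.natDegree_prod_le _ _).trans ?_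
    refine (Finset.sum_le_sum (fun i _ => hfd i)).trans ?_
    simp [mul_comm]
  obtain ⟨t, ht⟩ := Polynomial.exists_eval_ne_zero_of_natDegree_lt_card _ hP0
    (by rw [Cardinal.mk_fintype, ZMod.card]; exact_mod_cast lt_of_le_of_lt hPd hk)
  rw [Polynomial.eval_prod, Finset.prod_ne_zero_iff] at ht
  refine ⟨v t, hviso t, fun i => ?_⟩
  rw [← hfe]
  exact ht i (Finset.mem_univ i)

theorem exists_lift (G : Matrix (Fin 3) (Fin 3) ℤ) (hs : G.IsSymm) (l : ℕ) (hl : l.Prime)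
    (hl2 : l ≠ 2) (hD : ¬ (l : ℤ) ∣ G.det) (k : ℕ) (hk : 2 * k < l)
    (r : Fin k → Fin 3 → ℤ) (hr : ∀ i, ∃ j, ¬ (l : ℤ) ∣ r i j) :
    ∃ v : Fin 3 → ℤ, (l : ℤ) ∣ Bf G v v ∧ ∀ i, ¬ (l : ℤ) ∣ Bf G v (r i) := by
  have : Fact l.Prime := ⟨hl⟩
  have h2 : (2 : ZMod l) ≠ 0 := by
    intro h
    have h3 : ((2 : ℕ) : ZMod l) = 0 := by exact_mod_cast h
    rw [ZMod.natCast_eq_zero_iff] at h3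
    have := Nat.le_of_dvd (by norm_num) h3
    have := hl.two_le
    omega
  let ψ := Int.castRingHom (ZMod l)
  have hbf : ∀ x y : Fin 3 → ℤ, ((Bf G x y : ℤ) : ZMod l)
      = (fun i => (x i : ZMod l)) ⬝ᵥ (G.map ψ) *ᵥ (fun i => (y i : ZMod l)) := by
    intro x y
    simp only [Bf, dotProduct, Matrix.mulVec, Fin.sum_univ_three, Matrix.map_apply, ψ,
      Int.coe_castRingHom]
    push_cast
    ring
  have hdet : (G.map ψ).det = ((G.det : ℤ) : ZMod l) := by
    have := (RingHom.map_det ψ G).symm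
    simpa [ψ] using this
  obtain ⟨v, hv1, hv2⟩ := isotropic_avoid l h2 (G.map ψ) (by
      ext i j
      simp only [Matrix.transpose_apply, Matrix.map_apply]
      rw [hs.apply i j]) (by
      rw [hdet]
      intro h
      exact hD ((ZMod.intCast_zmod_eq_zero_iff_dvd _ _).1 h)) k hk (fun i j => (r i j : ZMod l)) (by
      intro i h
      obtain ⟨j, hj⟩ := hr i
      apply hj
      rw [← ZMod.intCast_zmod_eq_zero_iff_dvd]
      exact congrFun h j)
  choose w hw using fun i => ZMod.intCast_surjective (v i)
  have hw' : (fun i => (w i : ZMod l)) = v := funext hw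
  refine ⟨w, ?_, fun i => ?_⟩
  · rw [← ZMod.intCast_zmod_eq_zero_iff_dvd, hbf, hw', hv1]
  · rw [← ZMod.intCast_zmod_eq_zero_iff_dvd, hbf, hw']
    exact hv2 i

theorem solve_mod (l : ℤ) (hl : Prime l) (a b : ℤ) (ha : ¬ l ∣ a) : ∃ s, l ∣ b + s * a := by
  have hc : IsCoprime l a := (hl.irreducible.coprime_iff_not_dvd).2 ha
  obtain ⟨x, y, hxy⟩ := hc
  exact ⟨-b * y, b * x, by linear_combination (-b) * hxy⟩

theorem exists_v (G : Matrix (Fin 3) (Fin 3) ℤ) (hs : G.IsSymm) (l : ℕ) (hl : l.Prime)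
    (hl2 : l ≠ 2) (hD : ¬ (l : ℤ) ∣ G.det) (k : ℕ) (hk0 : 0 < k) (hk : 2 * k < l)
    (r : Fin k → Fin 3 → ℤ) (hr : ∀ i, ∃ j, ¬ (l : ℤ) ∣ r i j) :
    ∃ v : Fin 3 → ℤ, (∃ s : Fin 3 → ℤ, s 0 * v 0 + s 1 * v 1 + s 2 * v 2 = 1) ∧
      (l : ℤ) * l ∣ Bf G v v ∧ ∀ i, ¬ (l : ℤ) ∣ Bf G v (r i) := by
  obtain ⟨v, ⟨n, hn⟩, hv2⟩ := exists_lift G hs l hl hl2 hD k hk r hr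
  have hlp : Prime (l : ℤ) := Nat.prime_iff_prime_int.1 hl
  set w := r ⟨0, hk0⟩ with hw
  have hvw : ¬ (l : ℤ) ∣ Bf G v w := hv2 _
  have h2l : ¬ (l : ℤ) ∣ 2 := by
    intro h
    have := Int.le_of_dvd (by norm_num) h
    have := hl.two_le
    omega
  obtain ⟨s, m, hm⟩ := solve_mod l hlp (2 * Bf G v w) n (fun h => by
    rcases hlp.dvd_or_dvd h with h | h
    · exact h2l h
    · exact hvw h)
  set v' := v + ((l : ℤ) * s) • w with hv'
  have h1 : (l : ℤ) * l ∣ Bf G v' v' := by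
    refine ⟨m + s ^ 2 * Bf G w w, ?_⟩
    simp only [hv', bf_add_left, bf_add_right, bf_smul_left, bf_smul_right, bf_comm hs w v, hn]
    linear_combination (l : ℤ) * hm
  have h2 : ∀ i, ¬ (l : ℤ) ∣ Bf G v' (r i) := by
    intro i h
    apply hv2 i
    simp only [hv', bf_add_left, bf_smul_left] at h
    rw [mul_assoc] at h
    exact (dvd_add_left (dvd_mul_right _ _)).1 h
  -- divide by the content
  have hcont : ∃ d : ℤ, ∃ x : Fin 3 → ℤ, v' = d • x ∧
      ∃ s : Fin 3 → ℤ, s 0 * x 0 + s 1 * x 1 + s 2 * x 2 = 1 := by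
    have e1 := Int.gcd_eq_gcd_ab (v' 0) (v' 1)
    have e2 := Int.gcd_eq_gcd_ab (Int.gcd (v' 0) (v' 1) : ℤ) (v' 2)
    set d1 : ℤ := (Int.gcd (v' 0) (v' 1) : ℤ) with hd1
    set d : ℤ := (Int.gcd d1 (v' 2) : ℤ) with hd
    obtain ⟨x0, k1⟩ : d ∣ v' 0 := (Int.gcd_dvd_left _ _).trans (Int.gcd_dvd_left _ _)
    obtain ⟨x1, k2⟩ : d ∣ v' 1 := (Int.gcd_dvd_left _ _).trans (Int.gcd_dvd_right _ _)
    obtain ⟨x2, k3⟩ : d ∣ v' 2 := Int.gcd_dvd_right _ _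
    have hd0 : d ≠ 0 := by
      intro h
      apply h2 ⟨0, hk0⟩
      have : v' = 0 := by
        ext i
        fin_cases i
        · simpa [h] using k1
        · simpa [h] using k2
        · simpa [h] using k3
      rw [this]; simp [Bf]
    refine ⟨d, ![x0, x1, x2], ?_, ?_⟩
    · ext i
      fin_cases i
      · simpa using k1
      · simpa using k2
      · simpa using k3
    · refine ⟨![Int.gcdA d1 (v' 2) * Int.gcdA (v' 0) (v' 1),
        Int.gcdA d1 (v' 2) * Int.gcdB (v' 0) (v' 1), Int.gcdB d1 (v' 2)], ?_⟩
      apply mul_left_cancel₀ hd0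
      generalize d1.gcdA (v' 2) = A at *
      generalize d1.gcdB (v' 2) = B at *
      generalize (v' 0).gcdA (v' 1) = A' at *
      generalize (v' 0).gcdB (v' 1) = B' at *
      simp only [Matrix.cons_val_zero, Matrix.cons_val_one, Matrix.cons_val]
      linear_combination (-1 : ℤ) * e2 - A * e1 - A * A' * k1 - A * B' * k2 - B * k3
  obtain ⟨d, x, hx, hsx⟩ := hcont
  have hdl : ¬ (l : ℤ) ∣ d := by
    intro h
    apply h2 ⟨0, hk0⟩
    rw [hx, bf_smul_left]
    exact h.mul_right _
  refine ⟨x, hsx, ?_, fun i h => h2 i ?_⟩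
  · rw [hx, bf_smul_left, bf_smul_right, ← mul_assoc, ← pow_two] at h1
    rw [← pow_two]
    refine hlp.pow_dvd_of_dvd_mul_left 2 ?_ h1
    intro h
    rcases hlp.dvd_or_dvd h with h | h <;> exact hdl h
  · rw [hx, bf_smul_left]
    exact h.mul_left _

theorem gcd_split (a b : ℤ) : ∃ g a' b' x y : ℤ, a = g * a' ∧ b = g * b' ∧ x * a' + y * b' = 1 := by
  by_cases h : Int.gcd a b = 0
  · rw [Int.gcd_eq_zero_iff] at h
    exact ⟨0, 1, 0, 1, 0, by simp [h.1], by simp [h.2], by norm_num⟩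
  · obtain ⟨a', b', hcop, h1, h2⟩ := Int.exists_gcd_one (Nat.pos_of_ne_zero h)
    obtain ⟨x, y, hxy⟩ := Int.isCoprime_iff_gcd_eq_one.2 hcop
    exact ⟨Int.gcd a b, a', b', x, y, by rw [mul_comm]; exact h1, by rw [mul_comm]; exact h2, hxy⟩

theorem complete_basis (v : Fin 3 → ℤ) (hv : ∃ s : Fin 3 → ℤ, s 0 * v 0 + s 1 * v 1 + s 2 * v 2 = 1) :
    ∃ u w : Fin 3 → ℤ, (Matrix.of ![v, u, w]).det = 1 := by
  obtain ⟨s, hs⟩ := hv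
  obtain ⟨g, a, b, x, y, h0, h1, hxy⟩ := gcd_split (v 0) (v 1)
  refine ⟨![-y, x, 0], ![-s 2 * a, -s 2 * b, s 0 * a + s 1 * b], ?_⟩
  rw [Matrix.det_fin_three]
  simp
  rw [h0, h1] at hs ⊢
  linear_combination (x * a + y * b) * hs + hxy

theorem basis_coords (v u w : Fin 3 → ℤ) (hd : (Matrix.of ![v, u, w]).det = 1) (x : Fin 3 → ℤ) :
    ∃ a : Fin 3 → ℤ, x = a 0 • v + a 1 • u + a 2 • w := by
  rw [Matrix.det_fin_three] at hd
  simp at hd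
  refine ⟨![x 0 * (u 1 * w 2 - u 2 * w 1) + x 1 * (u 2 * w 0 - u 0 * w 2)
      + x 2 * (u 0 * w 1 - u 1 * w 0),
    x 0 * (w 1 * v 2 - w 2 * v 1) + x 1 * (w 2 * v 0 - w 0 * v 2)
      + x 2 * (w 0 * v 1 - w 1 * v 0),
    x 0 * (v 1 * u 2 - v 2 * u 1) + x 1 * (v 2 * u 0 - v 0 * u 2)
      + x 2 * (v 0 * u 1 - v 1 * u 0)], ?_⟩
  ext i
  fin_cases i
  · simp
    linear_combination (-x 0) * hd
  · simp
    linear_combination (-x 1) * hd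
  · simp
    linear_combination (-x 2) * hd

theorem exists_basis (G : Matrix (Fin 3) (Fin 3) ℤ) (l : ℤ) (hl : Prime l)
    (v : Fin 3 → ℤ) (hv : ∃ s : Fin 3 → ℤ, s 0 * v 0 + s 1 * v 1 + s 2 * v 2 = 1)
    (hvv : l ∣ Bf G v v) (ρ : Fin 3 → ℤ) (hρ : ¬ l ∣ Bf G v ρ) :
    ∃ u w : Fin 3 → ℤ, (Matrix.of ![v, u, w]).det = 1 ∧ ¬ l ∣ Bf G v u ∧ l ∣ Bf G v w
      := by
  obtain ⟨u, w, hd⟩ := complete_basis v hv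
  by_cases h : l ∣ Bf G v u
  · by_cases h' : l ∣ Bf G v w
    · exfalso
      obtain ⟨a, ha⟩ := basis_coords v u w hd ρ
      apply hρ
      rw [ha]
      simp only [bf_add_right, bf_smul_right]
      exact dvd_add (dvd_add (hvv.mul_left _) (h.mul_left _)) (h'.mul_left _)
    · refine ⟨w, (-1 : ℤ) • u, ?_, h', ?_⟩
      · rw [Matrix.det_fin_three] at hd ⊢
        simp at hd ⊢
        linear_combination hd
      · rw [bf_smul_right]; exact h.mul_left _
  · obtain ⟨k, hk⟩ := solve_mod l hl (Bf G v u) (Bf G v w) h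
    refine ⟨u, w + k • u, ?_, h, ?_⟩
    · rw [Matrix.det_fin_three] at hd ⊢
      simp at hd ⊢
      linear_combination hd
    · rw [bf_add_right, bf_smul_right]; exact hk

theorem padic_unit_add (l : ℕ) [Fact l.Prime] (u x : ℤ_[l]) (hu : IsUnit u) :
    IsUnit (u + (l : ℤ_[l]) * x) := by
  rw [PadicInt.isUnit_iff] at hu ⊢
  have h1 : ‖(l : ℤ_[l]) * x‖ < 1 := by
    rw [norm_mul]
    have := PadicInt.norm_le_one x
    have h2 : ‖(l : ℤ_[l])‖ < 1 := by
      rw [PadicInt.norm_p]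
      exact inv_lt_one_of_one_lt₀ (by exact_mod_cast (Fact.out : l.Prime).one_lt)
    have h3 := norm_nonneg (l : ℤ_[l])
    calc ‖(l : ℤ_[l])‖ * ‖x‖ ≤ ‖(l : ℤ_[l])‖ * 1 := by gcongr
      _ < 1 := by linarith
  rw [PadicInt.norm_add_eq_max_of_ne (by rw [hu]; exact h1.ne'), hu]
  exact max_eq_left h1.le

theorem padic_root (l : ℕ) [Fact l.Prime] (a b c : ℤ_[l]) (hb : IsUnit (2 * b)) :
    ∃ t : ℤ_[l], a + 2 * t * b + (l : ℤ_[l]) ^ 2 * t ^ 2 * c = 0 := by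
  obtain ⟨β, hβ⟩ := hb.exists_right_inv
  let F : Polynomial ℤ_[l] := Polynomial.C a + Polynomial.C (2 * b) * Polynomial.X
    + Polynomial.C ((l : ℤ_[l]) ^ 2 * c) * Polynomial.X ^ 2
  have hF : ∀ t, F.aeval t = a + 2 * t * b + (l : ℤ_[l]) ^ 2 * t ^ 2 * c := by
    intro t
    simp only [F, Polynomial.coe_aeval_eq_eval, Polynomial.eval_add, Polynomial.eval_mul,
      Polynomial.eval_C, Polynomial.eval_X, Polynomial.eval_pow]
    ring
  have hF' : ∀ t, F.derivative.aeval t = 2 * b + (l : ℤ_[l]) * (2 * l * t * c) := by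
    intro t
    simp only [F, Polynomial.coe_aeval_eq_eval, Polynomial.derivative_add,
      Polynomial.derivative_mul, Polynomial.derivative_C, Polynomial.derivative_X,
      Polynomial.derivative_X_pow, Polynomial.eval_add, Polynomial.eval_mul,
      Polynomial.eval_C, Polynomial.eval_X, Polynomial.eval_pow, Polynomial.eval_zero,
      Polynomial.eval_one]
    push_cast
    ring
  have hn1 : ‖F.derivative.aeval (-a * β)‖ = 1 := by
    rw [hF', ← PadicInt.isUnit_iff]
    exact padic_unit_add l _ _ hb
  have hn0 : ‖F.aeval (-a * β)‖ < ‖F.derivative.aeval (-a * β)‖ ^ 2 := by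
    rw [hn1, hF]
    have e : a + 2 * (-a * β) * b + (l : ℤ_[l]) ^ 2 * (-a * β) ^ 2 * c
        = (l : ℤ_[l]) * (l * (-a * β) ^ 2 * c) := by
      linear_combination (-a) * hβ
    rw [e, norm_mul]
    have := PadicInt.norm_le_one ((l : ℤ_[l]) * (-a * β) ^ 2 * c)
    have h2 : ‖(l : ℤ_[l])‖ < 1 := by
      rw [PadicInt.norm_p]
      exact inv_lt_one_of_one_lt₀ (by exact_mod_cast (Fact.out : l.Prime).one_lt)
    calc ‖(l : ℤ_[l])‖ * ‖(l : ℤ_[l]) * (-a * β) ^ 2 * c‖ ≤ ‖(l : ℤ_[l])‖ * 1 := by gcongr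
      _ < 1 ^ 2 := by linarith
  obtain ⟨t, ht, _⟩ := hensels_lemma hn0
  exact ⟨t, by rw [← hF, ht]⟩

theorem congr_of_common {R : Type*} [CommRing R] (A B F F' : Matrix (Fin 3) (Fin 3) R)
    (hF : F.det = 1) (hF' : F'.det = 1) (h : Fᵀ * A * F = F'ᵀ * B * F') :
    ∃ S : Matrix (Fin 3) (Fin 3) R, IsUnit S.det ∧ Sᵀ * A * S = B := by
  have h1 : F' * F'.adjugate = 1 := by rw [Matrix.mul_adjugate, hF', one_smul]
  refine ⟨F * F'.adjugate, ?_, ?_⟩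
  · rw [Matrix.det_mul, hF, Matrix.det_adjugate, hF']; simp
  · calc (F * F'.adjugate)ᵀ * A * (F * F'.adjugate)
        = (F'.adjugate)ᵀ * (Fᵀ * A * F) * F'.adjugate := by
          rw [Matrix.transpose_mul]; simp only [Matrix.mul_assoc]
      _ = (F' * F'.adjugate)ᵀ * B * (F' * F'.adjugate) := by
          rw [h, Matrix.transpose_mul]; simp only [Matrix.mul_assoc]
      _ = B := by rw [h1]; simp

theorem local_at_l {R : Type*} [CommRing R] (l a b e c f h τ z y x b' : R)
    (hb' : b' = b + l ^ 2 * τ * c)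
    (hτ : a + 2 * τ * b + l ^ 2 * τ ^ 2 * c = 0)
    (hz : c + 2 * z * b' = 0)
    (hy : e + l * τ * f + y * b' = 0)
    (hx : f + z * (l * e + l ^ 2 * τ * f) + x * b' = 0) :
    ∃ S : Matrix (Fin 3) (Fin 3) R, IsUnit S.det ∧
      Sᵀ * !![l ^ 2 * a, b, l * e; b, c, f; l * e, f, h] * S =
        !![a, b, e; b, l ^ 2 * c, l * f; e, l * f, h] := by
  apply congr_of_common _ _
    !![1, z, x + l * y * z; l ^ 2 * τ, 1 + z * (l ^ 2 * τ), x * (l ^ 2 * τ)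
      + l * y * (1 + z * (l ^ 2 * τ)); 0, 0, 1]
    !![1, l ^ 2 * z, l * x + y * (l ^ 2 * z); τ, 1 + l ^ 2 * z * τ,
      l * x * τ + y * (1 + l ^ 2 * z * τ); 0, 0, 1]
  · rw [Matrix.det_fin_three]; simp
  · rw [Matrix.det_fin_three]; simp [mul_assoc]
  · subst hb'
    ext i j
    fin_cases i <;> fin_cases j <;>
      simp [Matrix.mul_apply, Fin.sum_univ_three]
    · linear_combination (l ^ 2 - 1) * hτ
    · ring
    · linear_combination l * hy + (x + l * y * z) * l ^ 2 * hτ - hy - (x + l * y * z) * l * hτ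
    · ring
    · linear_combination hz + z ^ 2 * l ^ 2 * hτ - l ^ 2 * (hz + z ^ 2 * l ^ 2 * hτ)
    · linear_combination (1 - l) * (hx + x * z * l ^ 2 * hτ + l * y * (hz + z ^ 2 * l ^ 2 * hτ))
    · linear_combination l * hy + (x + l * y * z) * l ^ 2 * hτ - hy - (x + l * y * z) * l * hτ
    · linear_combination (1 - l) * (hx + x * z * l ^ 2 * hτ + l * y * (hz + z ^ 2 * l ^ 2 * hτ))
    · ring

theorem local_away {R : Type*} [CommRing R] (l k a b e c f h : R) (hk : k * l = 1) :
    ∃ S : Matrix (Fin 3) (Fin 3) R, IsUnit S.det ∧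
      Sᵀ * !![l ^ 2 * a, b, l * e; b, c, f; l * e, f, h] * S =
        !![a, b, e; b, l ^ 2 * c, l * f; e, l * f, h] := by
  refine ⟨!![k, 0, 0; 0, l, 0; 0, 0, 1], ?_, ?_⟩
  · rw [Matrix.det_fin_three]; simp [hk]
  · ext i j
    fin_cases i <;> fin_cases j <;>
      simp [Matrix.mul_apply, Fin.sum_univ_three]
    · linear_combination a * (k * l + 1) * hk
    · linear_combination b * hk
    · linear_combination e * hk
    · linear_combination b * hk
    · ring
    · linear_combination e * hk
    · ring

theorem genus_step (l : ℕ) (hl : l.Prime) (hl2 : l ≠ 2) (a b e c f h : ℤ)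
    (hb : ¬ (l : ℤ) ∣ b) :
    SameGenusM !![(l : ℤ) ^ 2 * a, b, l * e; b, c, f; l * e, f, h]
      !![a, b, e; b, (l : ℤ) ^ 2 * c, l * f; e, l * f, h] := by
  intro p hp
  have m1 : (!![(l : ℤ) ^ 2 * a, b, l * e; b, c, f; l * e, f, h]).map (Int.cast : ℤ → ℤ_[p])
      = !![(l : ℤ_[p]) ^ 2 * a, (b : ℤ_[p]), l * e; (b : ℤ_[p]), c, f; l * e, f, h] := by
    ext i j
    fin_cases i <;> fin_cases j <;> simp
  have m2 : (!![a, b, e; b, (l : ℤ) ^ 2 * c, l * f; e, l * f, h]).map (Int.cast : ℤ → ℤ_[p])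
      = !![(a : ℤ_[p]), b, e; b, (l : ℤ_[p]) ^ 2 * c, l * f; e, l * f, h] := by
    ext i j
    fin_cases i <;> fin_cases j <;> simp
  rw [m1, m2]
  by_cases hpl : p = l
  · subst hpl
    have unit_of : ∀ x : ℤ, ¬ (p : ℤ) ∣ x → IsUnit (x : ℤ_[p]) := by
      intro x hx
      rw [PadicInt.isUnit_iff]
      refine le_antisymm (PadicInt.norm_le_one _) (not_lt.1 fun h => hx ?_)
      exact (PadicInt.norm_int_lt_one_iff_dvd _).1 h
    have u2 : IsUnit (2 : ℤ_[p]) := by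
      have := unit_of 2 (fun h => by
        have := Int.le_of_dvd (by norm_num) h
        have := hl.two_le
        omega)
      exact_mod_cast this
    have ub := unit_of b hb
    obtain ⟨τ, hτ⟩ := padic_root p (a : ℤ_[p]) b c (u2.mul ub)
    have ub' : IsUnit ((b : ℤ_[p]) + (p : ℤ_[p]) ^ 2 * τ * c) := by
      have := padic_unit_add p b (p * τ * c) ub
      convert this using 2
      ring
    obtain ⟨i, hi⟩ := ub'.exists_right_inv
    obtain ⟨w, hw⟩ := u2.exists_right_inv
    refine local_at_l (p : ℤ_[p]) a b e c f h τ (- c * w * i) (-(e + p * τ * f) * i)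
      (-(f + (- c * w * i) * (p * e + p ^ 2 * τ * f)) * i) _ rfl hτ ?_ ?_ ?_
    · linear_combination (-c * 2 * w) * hi - c * hw
    · linear_combination (-(e + p * τ * f)) * hi
    · linear_combination (-(f + (- c * w * i) * (p * e + p ^ 2 * τ * f))) * hi
  · have ul : IsUnit ((l : ℕ) : ℤ_[p]) := by
      rw [PadicInt.isUnit_iff]
      refine le_antisymm (PadicInt.norm_le_one _) (not_lt.1 fun h => hpl ?_)
      have h2 : ‖((l : ℤ) : ℤ_[p])‖ < 1 := by simpa using h
      have := (PadicInt.norm_int_lt_one_iff_dvd _).1 h2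
      exact (Nat.prime_dvd_prime_iff_eq hp.out hl).1 (by exact_mod_cast this)
    obtain ⟨k, hk⟩ := ul.exists_left_inv
    exact local_away (l : ℤ_[p]) k a b e c f h hk

theorem genus_trans {A B C : Matrix (Fin 3) (Fin 3) ℤ} (h1 : SameGenusM A B)
    (h2 : SameGenusM B C) : SameGenusM A C := by
  intro p hp
  obtain ⟨S, hS, e1⟩ := h1 p
  obtain ⟨T, hT, e2⟩ := h2 p
  refine ⟨S * T, by rw [Matrix.det_mul]; exact hS.mul hT, ?_⟩
  rw [← e2, ← e1, Matrix.transpose_mul]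
  simp only [Matrix.mul_assoc]

theorem genus_base (A M : Matrix (Fin 3) (Fin 3) ℤ) (hM : M.det = 1) :
    SameGenusM A (M * A * Mᵀ) := by
  intro p hp
  refine ⟨Mᵀ.map (Int.castRingHom ℤ_[p]), ?_, ?_⟩
  · have := RingHom.map_det (Int.castRingHom ℤ_[p]) Mᵀ
    rw [RingHom.mapMatrix_apply] at this
    rw [← this, Matrix.det_transpose, hM]; simp
  · have : ∀ X : Matrix (Fin 3) (Fin 3) ℤ, X.map (Int.cast : ℤ → ℤ_[p])
        = X.map (Int.castRingHom ℤ_[p]) := fun X => rfl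
    rw [this, this, Matrix.map_mul, Matrix.map_mul, Matrix.transpose_map,
      Matrix.transpose_transpose]

/-- The data of an `l`-neighbour of the lattice `G`. -/
structure Nbr (G : Matrix (Fin 3) (Fin 3) ℤ) (l : ℤ) (v : Fin 3 → ℤ)
    (G' : Matrix (Fin 3) (Fin 3) ℤ) (Φ Ψ : (Fin 3 → ℤ) → (Fin 3 → ℤ)) : Prop where
  symm : G'.IsSymm
  pos : PosDefM G'
  genus : SameGenusM G G'
  det : G'.det = G.det
  phi : ∀ y z, Bf G (Φ y) (Φ z) = l ^ 2 * Bf G' y z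
  psi : ∀ x y, Bf G x (Φ y) = Bf G' (Ψ x) y
  red : ∀ y, ∃ w, Φ y = y 0 • v + l • w
  vdv : ∀ y, l ^ 2 ∣ Bf G v (Φ y)

theorem neighbor (G : Matrix (Fin 3) (Fin 3) ℤ) (hs : G.IsSymm) (hp : PosDefM G)
    (l : ℕ) (hl : l.Prime)
    (hl2 : l ≠ 2) (hD : ¬ (l : ℤ) ∣ G.det) (k : ℕ) (hk0 : 0 < k) (hk : 2 * k < l)
    (r : Fin k → Fin 3 → ℤ) (hr : ∀ i, ∃ j, ¬ (l : ℤ) ∣ r i j) :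
    ∃ v G' Φ Ψ, Nbr G l v G' Φ Ψ ∧ ∀ i, ¬ (l : ℤ) ∣ Bf G v (r i) := by
  obtain ⟨v, hv1, hv2, hv3⟩ := exists_v G hs l hl hl2 hD k hk0 hk r hr
  have hlp : Prime (l : ℤ) := Nat.prime_iff_prime_int.1 hl
  have hl0 : (l : ℤ) ≠ 0 := hlp.ne_zero
  obtain ⟨u, w, hM, hvu, e, hvw⟩ := exists_basis G l hlp v hv1 ((dvd_mul_right _ _).trans hv2)
    (r ⟨0, hk0⟩) (hv3 _)
  obtain ⟨a, ha⟩ := hv2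
  rw [← pow_two] at ha
  set b := Bf G v u with hb
  set c := Bf G u u with hc
  set f := Bf G u w with hf
  set h := Bf G w w with hh
  have hG1 : (Matrix.of ![v, u, w]) * G * (Matrix.of ![v, u, w])ᵀ
      = !![(l : ℤ) ^ 2 * a, b, l * e; b, c, f; l * e, f, h] := by
    have hent : ∀ i j, ((Matrix.of ![v, u, w]) * G * (Matrix.of ![v, u, w])ᵀ) i j
        = Bf G (![v, u, w] i) (![v, u, w] j) := by
      intro i j
      simp only [Bf, Matrix.mul_apply, dotProduct, Matrix.mulVec, Fin.sum_univ_three,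
        Matrix.transpose_apply, Matrix.of_apply]
      ring
    ext i j
    rw [hent]
    fin_cases i <;> fin_cases j <;>
      simp [ha, hvw, hb, hc, hf, hh, bf_comm hs u v, bf_comm hs w v, bf_comm hs w u]
  set G' : Matrix (Fin 3) (Fin 3) ℤ := !![a, b, e; b, (l : ℤ) ^ 2 * c, l * f; e, l * f, h] with hG'
  have hbf' : ∀ x y, Bf G' x y = x 0 * (a * y 0 + b * y 1 + e * y 2)
      + x 1 * (b * y 0 + (l : ℤ) ^ 2 * c * y 1 + l * f * y 2)
      + x 2 * (e * y 0 + l * f * y 1 + h * y 2) := by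
    intro x y
    simp [Bf, hG', dotProduct, Matrix.mulVec, Fin.sum_univ_three]
  let Φ : (Fin 3 → ℤ) → (Fin 3 → ℤ) := fun y =>
    y 0 • v + ((l : ℤ) ^ 2 * y 1) • u + ((l : ℤ) * y 2) • w
  choose co hco using fun x => basis_coords v u w hM x
  let Ψ : (Fin 3 → ℤ) → (Fin 3 → ℤ) := fun x =>
    ![(l : ℤ) ^ 2 * co x 0, co x 1, l * co x 2]
  have hphi : ∀ y z, Bf G (Φ y) (Φ z) = (l : ℤ) ^ 2 * Bf G' y z := by
    intro y z
    simp only [Φ, bf_add_left, bf_add_right, bf_smul_left, bf_smul_right, hbf',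
      bf_comm hs u v, bf_comm hs w v, bf_comm hs w u, ha, hvw, ← hb, ← hc, ← hf, ← hh]
    ring
  refine ⟨v, G', Φ, Ψ, ⟨?_, ?_, ?_, ?_, hphi, ?_, ?_, ?_⟩, hv3⟩
  · ext i j
    fin_cases i <;> fin_cases j <;> simp [hG']
  · intro y hy
    have hne : Φ y ≠ 0 := by
      intro h0
      have hb' : Matrix.vecMul ![y 0, (l : ℤ) ^ 2 * y 1, l * y 2] (Matrix.of ![v, u, w]) = 0 := by
        rw [← h0]
        ext i
        simp [Matrix.vecMul, dotProduct, Fin.sum_univ_three, Φ]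
      have h3 := Matrix.eq_zero_of_vecMul_eq_zero (by rw [hM]; norm_num) hb'
      apply hy
      have t0 := congrFun h3 0
      have t1 := congrFun h3 1
      have t2 := congrFun h3 2
      simp [hl.ne_zero] at t0 t1 t2
      ext i
      fin_cases i
      · exact t0
      · exact t1
      · exact t2
    have := hp _ hne
    rw [hphi] at this
    exact pos_of_mul_pos_right this (by positivity)
  · refine genus_trans (genus_base G _ hM) ?_
    rw [hG1]
    exact genus_step l hl hl2 a b e c f h hvu
  · have h1 : ((Matrix.of ![v, u, w]) * G * (Matrix.of ![v, u, w])ᵀ).det = G.det := by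
      rw [Matrix.det_mul, Matrix.det_mul, Matrix.det_transpose, hM]; ring
    rw [← h1, hG1, hG', Matrix.det_fin_three, Matrix.det_fin_three]
    simp
    ring
  · intro x y
    have := hco x
    conv_lhs => rw [this]
    simp only [Φ, Ψ, bf_add_left, bf_add_right, bf_smul_left, bf_smul_right, hbf',
      bf_comm hs u v, bf_comm hs w v, bf_comm hs w u, ha, hvw, ← hb, ← hc, ← hf, ← hh]
    simp
    ring
  · intro y
    refine ⟨((l : ℤ) * y 1) • u + y 2 • w, ?_⟩
    ext i
    simp [Φ]
    ring
  · intro y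
    refine ⟨a * y 0 + b * y 1 + e * y 2, ?_⟩
    simp only [Φ, bf_add_right, bf_smul_right, ha, hvw, ← hb]
    ring

/-- A system of three independent roots. -/
structure RootSys (G : Matrix (Fin 3) (Fin 3) ℤ) (r : Fin 3 → Fin 3 → ℤ) (c : Fin 3 → ℤ) :
    Prop where
  semi : ∀ i, Semi G (r i) (c i)
  prim : ∀ i, ∃ s : Fin 3 → ℤ, s 0 * r i 0 + s 1 * r i 1 + s 2 * r i 2 = 1
  det : (Matrix.of r).det ≠ 0

theorem exists_rootSys {G : Matrix (Fin 3) (Fin 3) ℤ} (hp : PosDefM G) (hr : ReflectiveM G) :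
    ∃ r c, RootSys G r c := by
  obtain ⟨r, h1, h2⟩ := three_roots hr
  choose c hc1 hc2 using fun i => root_good hp (h1 i)
  exact ⟨r, c, hc1, hc2, h2⟩

theorem rootSys_indep {G : Matrix (Fin 3) (Fin 3) ℤ} (hs : G.IsSymm) (hp : PosDefM G)
    {r : Fin 3 → Fin 3 → ℤ} {c : Fin 3 → ℤ} (h : RootSys G r c) {i j : Fin 3} (hij : i ≠ j) :
    Bf G (r i) (r j) ^ 2 < Bf G (r i) (r i) * Bf G (r j) (r j) := by
  by_contra hcon
  push Not at hcon
  have e := cauchy_eq hs hp _ _ hcon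
  apply h.det
  rw [← Matrix.exists_vecMul_eq_zero_iff]
  refine ⟨Pi.single j (Bf G (r i) (r i)) - Pi.single i (Bf G (r i) (r j)), ?_, ?_⟩
  · intro h0
    have := congrFun h0 j
    simp [hij.symm] at this
    exact (semi_pos (h.semi i)).ne' this
  · rw [Matrix.sub_vecMul, Matrix.single_vecMul, Matrix.single_vecMul]
    rw [sub_eq_zero]
    exact e

theorem rootSys_unique {G : Matrix (Fin 3) (Fin 3) ℤ} (hs : G.IsSymm) (hp : PosDefM G)
    (hsf : Squarefree G.det) {r : Fin 3 → Fin 3 → ℤ} {c : Fin 3 → ℤ} (h : RootSys G r c)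
    {q : ℤ} (hq : Prime q) (hq5 : 5 ≤ q) {i j : Fin 3} (hi : q ∣ c i) (hj : q ∣ c j) : i = j := by
  by_contra hij
  have h1 := lemK hs hsf hq hq5 (h.semi i) (h.semi j) (h.prim i) hi hj
  have h2 := rootSys_indep hs hp h hij
  linarith

theorem rootSys_orth {G : Matrix (Fin 3) (Fin 3) ℤ} (hs : G.IsSymm) (hp : PosDefM G)
    (hsf : Squarefree G.det) {r : Fin 3 → Fin 3 → ℤ} {c : Fin 3 → ℤ} (h : RootSys G r c)
    {q : ℤ} (hq : Prime q) (hq5 : 5 ≤ q) {i j : Fin 3} (hij : i ≠ j) (hi : q ∣ c i) :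
    Bf G (r i) (r j) = 0 := by
  by_contra hb
  exact hij (rootSys_unique hs hp hsf h hq hq5 hi
    (lemR hs hp hq hq5 (h.semi i) (h.semi j) hb hi))

theorem rootSys_zero {G : Matrix (Fin 3) (Fin 3) ℤ} (hD : G.det ≠ 0)
    {r : Fin 3 → Fin 3 → ℤ} {c : Fin 3 → ℤ} (h : RootSys G r c) (x : Fin 3 → ℤ)
    (hx : ∀ i, Bf G (r i) x = 0) : x = 0 := by
  have h1 : (Matrix.of r) *ᵥ (G *ᵥ x) = 0 := by
    ext i
    exact hx i
  exact Matrix.eq_zero_of_mulVec_eq_zero hD (Matrix.eq_zero_of_mulVec_eq_zero h.det h1)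

theorem kex {g c b : ℤ} (hg : 0 < g) (hc : 0 < c) (h1 : g ∣ b) (h2 : c ∣ b) (hb : b ≠ 0) :
    ∃ k : ℤ, 0 < k ∧ g * c * k ≤ b ^ 2 ∧
      (∀ p : ℤ, Prime p → p ∣ g → ¬ p ∣ c → p ∣ k) ∧
      (∀ p : ℤ, Prime p → p ∣ c → ¬ p ∣ g → p ∣ k) := by
  obtain ⟨h, g1, c1, t, hh, hg1, hc1, eg, ec, eb, hcop⟩ := lcmform hg hc h1 h2
  refine ⟨g1 * c1, by positivity, ?_, ?_, ?_⟩
  · have ht : t ≠ 0 := by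
      rintro rfl
      apply hb
      rw [eb, mul_zero]
    have ht1 : 1 ≤ t ^ 2 := by
      have : 0 < t ^ 2 := by positivity
      linarith
    rw [eb, eg, ec]
    have h0 : 0 ≤ (h * g1 * c1) ^ 2 := by positivity
    calc h * g1 * (h * c1) * (g1 * c1) = (h * g1 * c1) ^ 2 * 1 := by ring
      _ ≤ (h * g1 * c1) ^ 2 * t ^ 2 := mul_le_mul_of_nonneg_left ht1 h0
      _ = (h * g1 * c1 * t) ^ 2 := by ring
  · intro p hp hpg hpc
    rw [eg] at hpg
    rcases hp.dvd_or_dvd hpg with h' | h'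
    · exact absurd (ec ▸ h'.mul_right c1) hpc
    · exact h'.mul_right c1
  · intro p hp hpc hpg
    rw [ec] at hpc
    rcases hp.dvd_or_dvd hpc with h' | h'
    · exact absurd (eg ▸ h'.mul_right g1) hpg
    · exact h'.mul_left g1

theorem sf_dvd {K : ℤ} (E : ℤ) (hsf : Squarefree E)
    (h : ∀ p : ℤ, Prime p → 0 < p → p ∣ E → p ∣ K) : E ∣ K := by
  have h' : ∀ p : ℤ, Prime p → p ∣ E → p ∣ K := by
    intro p hp hpE
    have h1 : Prime |p| := by
      rcases abs_choice p with e | e <;> rw [e]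
      · exact hp
      · exact hp.neg
    exact (abs_dvd p K).1 (h _ h1 (abs_pos.2 hp.ne_zero) ((abs_dvd p E).2 hpE))
  clear h
  induction E using UniqueFactorizationMonoid.induction_on_prime with
  | h₁ => exact absurd hsf not_squarefree_zero
  | h₂ x hx => exact hx.dvd
  | h₃ a p ha hp ih =>
    have h1 := ih (hsf.squarefree_of_dvd (dvd_mul_left a p))
      (fun q hq hqa => h' q hq (hqa.mul_left p))
    have h2 := h' p hp (dvd_mul_right p a)
    have hpa : ¬ p ∣ a := by
      rintro ⟨m, rfl⟩
      exact hp.not_isUnit (hsf p ⟨m, by ring⟩)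
    exact ((hp.irreducible.coprime_iff_not_dvd).2 hpa).mul_dvd h2 h1

theorem nbr_root {G : Matrix (Fin 3) (Fin 3) ℤ} (hD : 0 < G.det)
    (htr : TotallyReflectiveM G) {l : ℤ} {v : Fin 3 → ℤ}
    {G' : Matrix (Fin 3) (Fin 3) ℤ} {Φ Ψ : (Fin 3 → ℤ) → (Fin 3 → ℤ)} (hn : Nbr G l v G' Φ Ψ)
    {Q : ℤ} (hQ : Prime Q) (hQ5 : 5 ≤ Q) (hQD : Q ∣ G.det) :
    ∃ r' g, Semi G' r' g ∧ Q ∣ g := by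
  obtain ⟨r, c, h⟩ := exists_rootSys hn.pos (htr G' hn.symm hn.pos hn.genus)
  obtain ⟨i, hi⟩ := lemE hn.symm hn.pos hQ hQ5 (by rw [hn.det]; exact hQD) (by rw [hn.det]; exact hD)
    r c h.semi h.det
  exact ⟨r i, c i, h.semi i, hi⟩

theorem nbr_indep {G : Matrix (Fin 3) (Fin 3) ℤ} (hs : G.IsSymm) (hp : PosDefM G)
    {l : ℤ} (hl : Prime l) (hl3 : 3 ≤ l) (hlD : ¬ l ∣ G.det) {v : Fin 3 → ℤ}
    {G' : Matrix (Fin 3) (Fin 3) ℤ} {Φ Ψ : (Fin 3 → ℤ) → (Fin 3 → ℤ)} (hn : Nbr G l v G' Φ Ψ)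
    {r' : Fin 3 → ℤ} {g : ℤ} (hr' : Semi G' r' g) {ρ : Fin 3 → ℤ} {c : ℤ} (hρ : Semi G ρ c)
    (hv : ¬ l ∣ Bf G v ρ) :
    Bf G ρ (Φ r') ^ 2 < Bf G ρ ρ * Bf G (Φ r') (Φ r') := by
  by_contra hcon
  push Not at hcon
  have e := cauchy_eq hs hp _ _ hcon
  have e2 := le_antisymm (cauchy hs hp ρ (Φ r')) hcon
  set β := Bf G ρ (Φ r') with hβ
  have e3 := congrArg (Bf G v) e
  rw [bf_smul_right, bf_smul_right] at e3
  have h2 : l ^ 2 ∣ β * Bf G v ρ := by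
    rw [← e3]; exact (hn.vdv r').mul_left _
  obtain ⟨m, hm⟩ := hl.pow_dvd_of_dvd_mul_right 2 hv h2
  rw [hn.phi, hm] at e2
  have hl0 : l ^ 2 ≠ 0 := pow_ne_zero 2 hl.ne_zero
  have e4 : l * (l * m ^ 2) = Bf G ρ ρ * Bf G' r' r' := by
    apply mul_left_cancel₀ hl0
    linear_combination e2
  have hd : l ∣ Bf G ρ ρ * Bf G' r' r' := ⟨_, e4.symm⟩
  rcases hl.dvd_or_dvd hd with h | h
  · rw [semi_prime hρ hl hl3] at h
    exact hlD (h.trans hρ.gD)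
  · rw [semi_prime hr' hl hl3] at h
    exact hlD (hn.det ▸ h.trans hr'.gD)

theorem prim_not_dvd {l : ℤ} (hl : Prime l) {r : Fin 3 → ℤ}
    (h : ∃ s : Fin 3 → ℤ, s 0 * r 0 + s 1 * r 1 + s 2 * r 2 = 1) : ∃ j, ¬ l ∣ r j := by
  by_contra hcon
  push Not at hcon
  obtain ⟨s, hs⟩ := h
  apply hl.not_isUnit
  apply isUnit_of_dvd_one
  rw [← hs]
  exact dvd_add (dvd_add ((hcon 0).mul_left _) ((hcon 1).mul_left _)) ((hcon 2).mul_left _)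

theorem semi_le {G : Matrix (Fin 3) (Fin 3) ℤ} {w : Fin 3 → ℤ} {g : ℤ} (h : Semi G w g) :
    Bf G w w ≤ 2 * g := by
  have := h.pos
  rcases h.nrm with a | a <;> rw [a]
  linarith

theorem genus_refl (G : Matrix (Fin 3) (Fin 3) ℤ) : SameGenusM G G := by
  have := genus_base G 1 Matrix.det_one
  simpa using this

theorem boundC1 {G : Matrix (Fin 3) (Fin 3) ℤ} (hs : G.IsSymm) (hp : PosDefM G)
    (hsf : Squarefree G.det) (hD : 0 < G.det) (htr : TotallyReflectiveM G)
    (l : ℕ) (hl : l.Prime) (hl3 : 3 ≤ l) (hlD : ¬ (l : ℤ) ∣ G.det)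
    {Q : ℤ} (hQ : Prime Q) (hQ5 : 5 ≤ Q) (hQD : Q ∣ G.det) : Q ≤ 4 * (l : ℤ) ^ 2 := by
  have hlp : Prime (l : ℤ) := Nat.prime_iff_prime_int.1 hl
  obtain ⟨r, c, h⟩ := exists_rootSys hp (htr G hs hp (genus_refl G))
  obtain ⟨i, hi⟩ := lemE hs hp hQ hQ5 hQD hD r c h.semi h.det
  obtain ⟨v, G', Φ, Ψ, hn, hv⟩ := neighbor G hs hp l hl (by omega) hlD 1 one_pos (by omega)
    (fun _ => r i) (fun _ => prim_not_dvd hlp (h.prim i))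
  obtain ⟨r', g, hr', hQg⟩ := nbr_root hD htr hn hQ hQ5 hQD
  have hind := nbr_indep hs hp hlp (by exact_mod_cast hl3) hlD hn hr' (h.semi i) (hv 0)
  set y := Φ r' with hy
  have hgy : ∀ x, g ∣ Bf G x y := fun x => by rw [hn.psi]; exact hr'.dv _
  have hex : ∃ j, j ≠ i ∧ Bf G (r j) y ≠ 0 := by
    by_contra hcon
    push Not at hcon
    have hz : Bf G (r i) (r i) • y - Bf G (r i) y • r i = 0 := by
      apply rootSys_zero hD.ne' h
      intro j
      rw [bf_sub_right, bf_smul_right, bf_smul_right]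
      by_cases hji : j = i
      · subst hji; ring
      · rw [hcon j hji, bf_comm hs (r j) (r i), rootSys_orth hs hp hsf h hQ hQ5 (Ne.symm hji) hi]
        ring
    have := congrArg (Bf G y) hz
    rw [bf_sub_right, bf_smul_right, bf_smul_right, bf_comm hs y (r i)] at this
    have h0 : Bf G y 0 = 0 := by simp [Bf]
    rw [h0] at this
    linarith
  obtain ⟨j, hji, hj⟩ := hex
  have hcj : ¬ Q ∣ c j := fun h' => hji (rootSys_unique hs hp hsf h hQ hQ5 h' hi)
  obtain ⟨k, hk, hle, hk1, _⟩ := kex hr'.pos (h.semi j).pos (hgy (r j))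
    (by rw [bf_comm hs]; exact (h.semi j).dv y) hj
  have hQk := Int.le_of_dvd hk (hk1 Q hQ hQg hcj)
  have hcs := cauchy hs hp (r j) y
  have hN := hn.phi r' r'
  rw [← hy] at hN
  have a1 := semi_le hr'
  have a2 := semi_le (h.semi j)
  have g0 := hr'.pos
  have c0 := (h.semi j).pos
  have hgc : 0 < g * c j := by positivity
  have : g * c j * k ≤ g * c j * (4 * (l : ℤ) ^ 2) := by
    calc g * c j * k ≤ Bf G (r j) (r j) * Bf G y y := hle.trans hcs
      _ ≤ (2 * c j) * ((l : ℤ) ^ 2 * (2 * g)) := by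
        rw [hN]
        have := (semi_pos (h.semi j)).le
        have := (semi_pos hr').le
        gcongr
      _ = g * c j * (4 * (l : ℤ) ^ 2) := by ring
  exact hQk.trans (le_of_mul_le_mul_left this hgc)

theorem arith3 {g n1 n2 n3 k1 k2 k3 b1 b2 b3 N L : ℤ} (hg : 0 < g) (h1 : 0 < n1) (h2 : 0 < n2)
    (h3 : 0 < n3) (e1 : g * n1 * k1 ≤ 2 * b1 ^ 2) (e2 : g * n2 * k2 ≤ 2 * b2 ^ 2)
    (e3 : g * n3 * k3 ≤ 2 * b3 ^ 2)
    (hB : b1 ^ 2 * (n2 * n3) + b2 ^ 2 * (n1 * n3) + b3 ^ 2 * (n1 * n2) ≤ N * (n1 * n2 * n3))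
    (hN : N ≤ L * (2 * g)) : k1 + k2 + k3 ≤ 4 * L := by
  have hp : 0 < g * (n1 * n2 * n3) := by positivity
  have f1 := mul_le_mul_of_nonneg_right e1 (show 0 ≤ n2 * n3 by positivity)
  have f2 := mul_le_mul_of_nonneg_right e2 (show 0 ≤ n1 * n3 by positivity)
  have f3 := mul_le_mul_of_nonneg_right e3 (show 0 ≤ n1 * n2 by positivity)
  have f4 := mul_le_mul_of_nonneg_right hN (show 0 ≤ n1 * n2 * n3 by positivity)
  refine le_of_mul_le_mul_left ?_ hp
  linarith

theorem arith2 {g n1 n2 k1 k2 b1 b2 N L : ℤ} (hg : 0 < g) (h1 : 0 < n1) (h2 : 0 < n2)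
    (e1 : g * n1 * k1 ≤ 2 * b1 ^ 2) (e2 : g * n2 * k2 ≤ 2 * b2 ^ 2)
    (hB : b1 ^ 2 * n2 + b2 ^ 2 * n1 ≤ N * (n1 * n2))
    (hN : N ≤ L * (2 * g)) : k1 + k2 ≤ 4 * L := by
  have hp : 0 < g * (n1 * n2) := by positivity
  have f1 := mul_le_mul_of_nonneg_right e1 h2.le
  have f2 := mul_le_mul_of_nonneg_right e2 h1.le
  have f4 := mul_le_mul_of_nonneg_right hN (show 0 ≤ n1 * n2 by positivity)
  refine le_of_mul_le_mul_left ?_ hp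
  linarith

theorem amgm3 {a b c S : ℤ} (ha : 0 < a) (hb : 0 < b) (hc : 0 < c) (h : a + b + c ≤ S) :
    27 * (a * b * c) ≤ S ^ 3 := by
  have h1 : 27 * (a * b * c) ≤ (a + b + c) ^ 3 := by
    nlinarith [mul_nonneg ha.le (sq_nonneg (b - c)), mul_nonneg hb.le (sq_nonneg (a - c)),
      mul_nonneg hc.le (sq_nonneg (a - b)), mul_nonneg ha.le (sq_nonneg (a - b)),
      mul_nonneg ha.le (sq_nonneg (a - c)), mul_nonneg hb.le (sq_nonneg (a - b)),
      mul_nonneg hb.le (sq_nonneg (b - c)), mul_nonneg hc.le (sq_nonneg (a - c)),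
      mul_nonneg hc.le (sq_nonneg (b - c))]
  exact h1.trans (pow_le_pow_left₀ (by positivity) h 3)

theorem boundC2 {G : Matrix (Fin 3) (Fin 3) ℤ} (hs : G.IsSymm) (hp : PosDefM G)
    (hsf : Squarefree G.det) (hD : 0 < G.det) (htr : TotallyReflectiveM G)
    (l : ℕ) (hl : l.Prime) (hl7 : 7 ≤ l) (hlD : ¬ (l : ℤ) ∣ G.det)
    {Q E : ℤ} (hQ : Prime Q) (hE0 : 0 < E) (hQE : Q ∣ E) (hQ0 : 0 < Q) (hED : E ∣ G.det)
    (hE : ∀ p : ℤ, Prime p → 0 < p → p ∣ E → 5 ≤ p) :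
    E ≤ 4 * (l : ℤ) ^ 4 ∨ 27 * (Q * E) ≤ 64 * (l : ℤ) ^ 6 := by
  have hlp : Prime (l : ℤ) := Nat.prime_iff_prime_int.1 hl
  have hQ5 := hE Q hQ hQ0 hQE
  have hQD := hQE.trans hED
  have hEsf : Squarefree E := hsf.squarefree_of_dvd hED
  obtain ⟨r, c, h⟩ := exists_rootSys hp (htr G hs hp (genus_refl G))
  obtain ⟨i0, hi0⟩ := lemE hs hp hQ hQ5 hQD hD r c h.semi h.det
  obtain ⟨v, G', Φ, Ψ, hn, hv⟩ := neighbor G hs hp l hl (by omega) hlD 3 (by norm_num) (by omega)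
    r (fun i => prim_not_dvd hlp (h.prim i))
  obtain ⟨r', g, hr', hQg⟩ := nbr_root hD htr hn hQ hQ5 hQD
  have hind := nbr_indep hs hp hlp (by exact_mod_cast (by omega : 3 ≤ l)) hlD hn hr'
    (h.semi i0) (hv i0)
  have hN := hn.phi r' r'
  have hgD : g ∣ G.det := hn.det ▸ hr'.gD
  have hgl : ¬ (l : ℤ) ∣ g := fun h' => hlD (h'.trans hgD)
  have hcop : IsCoprime g (l : ℤ) := ((hlp.irreducible.coprime_iff_not_dvd).2 hgl).symm
  obtain ⟨w, hw⟩ := hn.red r'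
  have hgy : ∀ x, g ∣ Bf G x (Φ r') := fun x => by rw [hn.psi]; exact hr'.dv _
  have hl2 : (0 : ℤ) < (l : ℤ) ^ 2 := by positivity
  -- the first coordinate is a unit modulo l
  have hr0 : ¬ (l : ℤ) ∣ r' 0 := by
    rintro ⟨m, hm⟩
    have hyx : Φ r' = (l : ℤ) • (m • v + w) := by
      rw [hw, hm, smul_add, smul_smul]
    set x := m • v + w with hx
    have hNx : Bf G x x = Bf G' r' r' := by
      rw [hyx, bf_smul_left, bf_smul_right] at hN
      apply mul_left_cancel₀ hl2.ne'
      linear_combination hN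
    have hsx : Semi G x g := by
      refine ⟨hr'.pos, fun z => ?_, ?_, hgD⟩
      · have := hgy z
        rw [hyx, bf_smul_right] at this
        exact hcop.dvd_of_dvd_mul_left this
      · rw [hNx]; exact hr'.nrm
    have hK := lemK hs hsf hQ hQ5 (h.semi i0) hsx (h.prim i0) hi0 hQg
    rw [hyx, bf_smul_right, bf_smul_left, bf_smul_right] at hind
    have := mul_le_mul_of_nonneg_left hK hl2.le
    linarith
  have hbne : ∀ i, Bf G (Φ r') (r i) ≠ 0 := by
    intro i h0
    rw [hw, bf_add_left, bf_smul_left, bf_smul_left] at h0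
    have : (l : ℤ) ∣ r' 0 * Bf G v (r i) := ⟨- Bf G w (r i), by linarith⟩
    rcases hlp.dvd_or_dvd this with h' | h'
    · exact hr0 h'
    · exact hv i h'
  set y := Φ r' with hy
  have hkex : ∀ i, ∃ k : ℤ, 0 < k ∧ g * c i * k ≤ (Bf G y (r i)) ^ 2 ∧
      (∀ p : ℤ, Prime p → p ∣ g → ¬ p ∣ c i → p ∣ k) ∧
      (∀ p : ℤ, Prime p → p ∣ c i → ¬ p ∣ g → p ∣ k) := fun i =>
    kex hr'.pos (h.semi i).pos (by rw [bf_comm hs]; exact hgy (r i)) ((h.semi i).dv y) (hbne i)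
  choose k hk0 hkle hkg hkc using hkex
  have hg0 := hr'.pos
  have hn0 : ∀ i, 0 < Bf G (r i) (r i) := fun i => semi_pos (h.semi i)
  have hkn : ∀ i, g * Bf G (r i) (r i) * k i ≤ 2 * Bf G y (r i) ^ 2 := by
    intro i
    have h1 := semi_le (h.semi i)
    have h2 := hkle i
    have h3 := mul_le_mul_of_nonneg_left h1 (show 0 ≤ g * k i from
      mul_nonneg hg0.le (hk0 i).le)
    linarith
  have hNy : Bf G y y ≤ (l : ℤ) ^ 2 * (2 * g) := by
    rw [hN]
    exact mul_le_mul_of_nonneg_left (semi_le hr') hl2.le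
  have huniq : ∀ p : ℤ, Prime p → 0 < p → p ∣ E → ∃ i, p ∣ c i ∧ ∀ j, j ≠ i → ¬ p ∣ c j := by
    intro p hpp hp0 hpE
    have hp5 := hE p hpp hp0 hpE
    obtain ⟨i, hi⟩ := lemE hs hp hpp hp5 (hpE.trans hED) hD r c h.semi h.det
    exact ⟨i, hi, fun j hj hj' => hj (rootSys_unique hs hp hsf h hpp hp5 hj' hi)⟩
  by_cases horth : ∀ a b, a ≠ b → Bf G (r a) (r b) = 0
  · right
    have hB := bessel3 hs hp y (r 0) (r 1) (r 2) (hn0 0) (hn0 1) (hn0 2)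
      (horth 0 1 (by decide)) (horth 0 2 (by decide)) (horth 1 2 (by decide))
    have hsum := arith3 hg0 (hn0 0) (hn0 1) (hn0 2) (hkn 0) (hkn 1) (hkn 2) hB hNy
    have ham := amgm3 (hk0 0) (hk0 1) (hk0 2) hsum
    have hdiv : Q * E ∣ k 0 * k 1 * k 2 := by
      obtain ⟨E', hE'⟩ := hQE
      have hQE' : ¬ Q ∣ E' := by
        rintro ⟨m, rfl⟩
        exact hQ.not_isUnit (hEsf Q ⟨m, by rw [hE']; ring⟩)
      have hE'sf : Squarefree E' := hEsf.squarefree_of_dvd ⟨Q, by rw [hE']; ring⟩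
      have hQk : ∀ j, j ≠ i0 → Q ∣ k j := fun j hj => hkg j Q hQ hQg
        (fun h' => hj (rootSys_unique hs hp hsf h hQ hQ5 h' hi0))
      have hQ2 : Q * Q ∣ k 0 * k 1 * k 2 := by
        fin_cases i0
        · exact (mul_dvd_mul (hQk 1 (by decide)) (hQk 2 (by decide))).trans ⟨k 0, by ring⟩
        · exact (mul_dvd_mul (hQk 0 (by decide)) (hQk 2 (by decide))).trans ⟨k 1, by ring⟩
        · exact (mul_dvd_mul (hQk 0 (by decide)) (hQk 1 (by decide))).trans ⟨k 2, by ring⟩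
      have hE'k : E' ∣ k 0 * k 1 * k 2 := by
        apply sf_dvd E' hE'sf
        intro p hpp hp0 hpE'
        have hpE : p ∣ E := by rw [hE']; exact hpE'.mul_left Q
        obtain ⟨i, hi, hj⟩ := huniq p hpp hp0 hpE
        have : ∃ j, p ∣ k j := by
          by_cases hpg : p ∣ g
          · exact ⟨i + 1, hkg _ p hpp hpg (hj _ (by fin_cases i <;> decide))⟩
          · exact ⟨i, hkc i p hpp hi hpg⟩
        obtain ⟨j, hj⟩ := this
        fin_cases j
        · exact hj.trans ⟨k 1 * k 2, by simp; ring⟩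
        · exact hj.trans ⟨k 0 * k 2, by simp; ring⟩
        · exact hj.trans ⟨k 0 * k 1, by simp; ring⟩
      have hco : IsCoprime (Q * Q) E' := by
        have := (hQ.irreducible.coprime_iff_not_dvd).2 hQE'
        exact this.mul_left this
      have := hco.mul_dvd hQ2 hE'k
      rw [hE']
      rwa [mul_assoc] at this
    have hle := Int.le_of_dvd (mul_pos (mul_pos (hk0 0) (hk0 1)) (hk0 2)) hdiv
    nlinarith
  · left
    push Not at horth
    obtain ⟨a, b, hab, hne⟩ := horth
    obtain ⟨d, hda, hdb, hcov⟩ : ∃ d : Fin 3, d ≠ a ∧ d ≠ b ∧ ∀ j, j = a ∨ j = b ∨ j = d := by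
      revert hab
      clear hne
      revert a b
      decide
    have hcd : ∀ p : ℤ, Prime p → 0 < p → p ∣ E → p ∣ c d ∧ ¬ p ∣ c a := by
      intro p hpp hp0 hpE
      have hp5 := hE p hpp hp0 hpE
      obtain ⟨i, hi, hj⟩ := huniq p hpp hp0 hpE
      have hia : i ≠ a := by
        rintro rfl
        exact hj b hab.symm (lemR hs hp hpp hp5 (h.semi i) (h.semi b) hne hi)
      have hib : i ≠ b := by
        rintro rfl
        exact hj a hab (lemR hs hp hpp hp5 (h.semi i) (h.semi a) (by rwa [bf_comm hs]) hi)
      have hid : i = d := ((hcov i).resolve_left hia).resolve_left hib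
      subst hid
      exact ⟨hi, hj a hda.symm⟩
    have hor := rootSys_orth hs hp hsf h hQ hQ5 hda (hcd Q hQ hQ0 hQE).1
    have hB := bessel2 hs hp y (r d) (r a) (hn0 d) (hn0 a) hor
    have hsum := arith2 hg0 (hn0 d) (hn0 a) (hkn d) (hkn a) hB hNy
    have hdiv : E ∣ k d * k a := by
      apply sf_dvd E hEsf
      intro p hpp hp0 hpE
      obtain ⟨h1, h2⟩ := hcd p hpp hp0 hpE
      by_cases hpg : p ∣ g
      · exact (hkg a p hpp hpg h2).mul_left _
      · exact (hkc d p hpp h1 hpg).mul_right _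
    have hle := Int.le_of_dvd (mul_pos (hk0 d) (hk0 a)) hdiv
    nlinarith [sq_nonneg (k d - k a), hk0 d, hk0 a, mul_self_le_mul_self
      (add_pos (hk0 d) (hk0 a)).le hsum]

theorem tail_primes (D : ℕ) : ∀ n : ℕ, 43 ≤ n → (∀ p : ℕ, p.Prime → 7 ≤ p → p < n → p ∣ D) →
    ∃ S : Finset ℕ, (∀ p ∈ S, p.Prime ∧ p ∣ D ∧ 7 ≤ p ∧ p < n) ∧ 7 ∈ S ∧
      64 * n ^ 6 < 189 * ∏ p ∈ S, p := by
  intro n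
  induction n using Nat.strong_induction_on with
  | _ n ih =>
    intro hn h
    by_cases hb : n < 128
    · refine ⟨{7, 11, 13, 17, 19, 23, 29, 31, 37, 41}, ?_, by decide, ?_⟩
      · intro p hp
        have hp' : p.Prime ∧ 7 ≤ p ∧ p < 43 := by
          simp only [Finset.mem_insert, Finset.mem_singleton] at hp
          rcases hp with rfl | rfl | rfl | rfl | rfl | rfl | rfl | rfl | rfl | rfl <;> norm_num
        exact ⟨hp'.1, h p hp'.1 hp'.2.1 (by omega), hp'.2.1, by omega⟩
      · have h1 : n ^ 6 ≤ 127 ^ 6 := Nat.pow_le_pow_left (by omega) 6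
        have h2 : ∏ p ∈ ({7, 11, 13, 17, 19, 23, 29, 31, 37, 41} : Finset ℕ), p
            = 10141675450907 := by decide
        rw [h2]
        omega
    · push Not at hb
      obtain ⟨m, hm1, hm2⟩ : ∃ m, 2 * m < n ∧ n ≤ 2 * (m + 1) := ⟨(n - 1) / 2, by omega, by omega⟩
      obtain ⟨S, hS, h7, hlt⟩ := ih (m + 1) (by omega) (by omega)
        (fun p hp hp7 hpm => h p hp hp7 (by omega))
      obtain ⟨p, hp, hmp, hp2⟩ := Nat.exists_prime_lt_and_le_two_mul m (by omega)
      have hpS : p ∉ S := fun h' => by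
        have := (hS p h').2.2.2
        omega
      refine ⟨insert p S, ?_, Finset.mem_insert_of_mem h7, ?_⟩
      · intro x hx
        rcases Finset.mem_insert.1 hx with rfl | hx
        · exact ⟨hp, h _ hp (by omega) (by omega), by omega, by omega⟩
        · obtain ⟨a, b, c, d⟩ := hS x hx
          exact ⟨a, b, c, by omega⟩
      · rw [Finset.prod_insert hpS]
        have h1 : n ^ 6 ≤ (2 * (m + 1)) ^ 6 := Nat.pow_le_pow_left hm2 6
        have h2 : (2 * (m + 1)) ^ 6 = 64 * (m + 1) ^ 6 := by ring
        have h3 : 64 * (64 * (m + 1) ^ 6) < p * (189 * ∏ x ∈ S, x) :=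
          Nat.mul_lt_mul_of_le_of_lt (by omega) hlt (by omega)
        calc 64 * n ^ 6 ≤ 64 * (64 * (m + 1) ^ 6) := by omega
          _ < p * (189 * ∏ x ∈ S, x) := h3
          _ = _ := by ring

/-- Arithmetic core: the two bounds applied to products of distinct primes. -/
theorem numerics (D : ℕ) (hD : 0 < D)
    (H1 : ∀ l : ℕ, l.Prime → 3 ≤ l → ¬ l ∣ D → ∀ Q : ℕ, Q.Prime → 5 ≤ Q → Q ∣ D → Q ≤ 4 * l ^ 2)
    (H2 : ∀ l : ℕ, l.Prime → 7 ≤ l → ¬ l ∣ D → ∀ S : Finset ℕ,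
      (∀ p ∈ S, p.Prime ∧ p ∣ D ∧ 5 ≤ p) → ∀ Q ∈ S,
        ∏ p ∈ S, p ≤ 4 * l ^ 4 ∨ 27 * (Q * ∏ p ∈ S, p) ≤ 64 * l ^ 6)
    (s : ℕ) (q : Fin s → ℕ) (hq : ∀ i, (q i).Prime) (hmono : StrictMono q)
    (hdv : ∀ i, q i ∣ D) (hmem : ∀ p : ℕ, p.Prime → p ∣ D → ∃ i, q i = p) (i : Fin s) :
    q i ≤ [89, 257, 733, 1063, 1033, 607, 293, 113, 37].getD (i : ℕ) 0 := by
  -- the list version of the second bound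
  have HL : ∀ l : ℕ, l.Prime → 7 ≤ l → ¬ l ∣ D → ∀ (L : List ℕ) (l0 e0 Q Q0 : ℕ), l ≤ l0 →
      L.Nodup → (∀ p ∈ L, p.Prime ∧ p ∣ D ∧ 5 ≤ p) → Q ∈ L → Q0 ≤ Q → e0 ≤ L.prod →
      4 * l0 ^ 4 < e0 → 64 * l0 ^ 6 < 27 * (Q0 * e0) → False := by
    intro l hl hl7 hlD L l0 e0 Q Q0 hll hnd hL hQL hQ0 he0 n1 n2
    have h := H2 l hl hl7 hlD L.toFinset (fun p hp => hL p (List.mem_toFinset.1 hp)) Q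
      (List.mem_toFinset.2 hQL)
    have e : ∏ p ∈ L.toFinset, p = L.prod := by
      have := List.prod_toFinset (fun x : ℕ => x) hnd
      simpa using this
    rw [e] at h
    have a1 : l ^ 4 ≤ l0 ^ 4 := Nat.pow_le_pow_left hll 4
    have a2 : l ^ 6 ≤ l0 ^ 6 := Nat.pow_le_pow_left hll 6
    have a3 : Q0 * e0 ≤ Q * L.prod := Nat.mul_le_mul hQ0 he0
    rcases h with h | h <;> omega
  -- the least good prime
  have hex : ∃ l : ℕ, l.Prime ∧ 7 ≤ l ∧ ¬ l ∣ D := by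
    obtain ⟨p, hp1, hp2⟩ := Nat.exists_infinite_primes (D + 7)
    exact ⟨p, hp2, by omega, fun h => by have := Nat.le_of_dvd hD h; omega⟩
  classical
  obtain ⟨l, ⟨hl, hl7, hlD⟩, hmin⟩ : ∃ l : ℕ, (l.Prime ∧ 7 ≤ l ∧ ¬ l ∣ D) ∧
      ∀ p : ℕ, p.Prime → 7 ≤ p → p < l → p ∣ D := by
    refine ⟨Nat.find hex, Nat.find_spec hex, fun p hp hp7 hpl => ?_⟩
    by_contra hcon
    exact Nat.find_min hex hpl ⟨hp, hp7, hcon⟩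
  have hl43 : l < 43 := by
    by_contra hcon
    push Not at hcon
    obtain ⟨S, hS, h7, hlt⟩ := tail_primes D l hcon hmin
    have h := H2 l hl hl7 hlD S (fun p hp => ⟨(hS p hp).1, (hS p hp).2.1, by
      have := (hS p hp).2.2.1; omega⟩) 7 h7
    have h4 : 43 ^ 2 * l ^ 4 ≤ l ^ 6 := by
      calc 43 ^ 2 * l ^ 4 ≤ l ^ 2 * l ^ 4 :=
            Nat.mul_le_mul_right _ (Nat.pow_le_pow_left hcon 2)
        _ = l ^ 6 := by ring
    rcases h with h | h <;> omega
  -- the indexed primes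
  have hlt : ∀ (j k : ℕ) (hj : j < s) (hk : k < s), j < k → q ⟨j, hj⟩ < q ⟨k, hk⟩ :=
    fun j k hj hk h => hmono h
  have step : ∀ (j : ℕ) (hj : j + 1 < s) (a b : ℕ), a ≤ q ⟨j, by omega⟩ →
      (∀ x, a < x → x < b → ¬ x.Prime) → b ≤ q ⟨j + 1, hj⟩ := by
    intro j hj a b ha hb
    by_contra hcon
    have := hlt j (j + 1) (by omega) hj (by omega)
    exact hb _ (by omega) (by omega) (hq ⟨j + 1, hj⟩)
  have b0 : ∀ h : 0 < s, 2 ≤ q ⟨0, h⟩ := fun h => (hq _).two_le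
  have b1 : ∀ h : 1 < s, 3 ≤ q ⟨1, h⟩ := fun h => step 0 h 2 3 (b0 _) (by intro x; omega)
  have b2 : ∀ h : 2 < s, 5 ≤ q ⟨2, h⟩ := fun h => step 1 h 3 5 (b1 _)
    (by intro x h1 h2; interval_cases x; norm_num)
  have b3 : ∀ h : 3 < s, 7 ≤ q ⟨3, h⟩ := fun h => step 2 h 5 7 (b2 _)
    (by intro x h1 h2; interval_cases x; norm_num)
  have b4 : ∀ h : 4 < s, 11 ≤ q ⟨4, h⟩ := fun h => step 3 h 7 11 (b3 _)
    (by intro x h1 h2; interval_cases x <;> norm_num)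
  have b5 : ∀ h : 5 < s, 13 ≤ q ⟨5, h⟩ := fun h => step 4 h 11 13 (b4 _)
    (by intro x h1 h2; interval_cases x; norm_num)
  have b6 : ∀ h : 6 < s, 17 ≤ q ⟨6, h⟩ := fun h => step 5 h 13 17 (b5 _)
    (by intro x h1 h2; interval_cases x <;> norm_num)
  have b7 : ∀ h : 7 < s, 19 ≤ q ⟨7, h⟩ := fun h => step 6 h 17 19 (b6 _)
    (by intro x h1 h2; interval_cases x; norm_num)
  have b8 : ∀ h : 8 < s, 23 ≤ q ⟨8, h⟩ := fun h => step 7 h 19 23 (b7 _)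
    (by intro x h1 h2; interval_cases x <;> norm_num)
  have b9 : ∀ h : 9 < s, 29 ≤ q ⟨9, h⟩ := fun h => step 8 h 23 29 (b8 _)
    (by intro x h1 h2; interval_cases x <;> norm_num)
  -- the first bound: among `n + 1` odd primes below `q i`, one does not divide `D`
  have HC : ∀ (T : Finset ℕ) (B : ℕ), (i : ℕ) < T.card →
      (∀ p ∈ T, p.Prime ∧ 3 ≤ p ∧ 4 * p ^ 2 ≤ B ∧ p ≤ B) → 5 ≤ B → q i ≤ B := by
    intro T B hT hTB hB
    by_contra hcon
    push Not at hcon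
    have hsub : T ⊆ (Finset.univ.filter (fun j => j < i)).image q := by
      intro p hp
      obtain ⟨hpp, hp3, hpB, hpB'⟩ := hTB p hp
      have hpD : p ∣ D := by
        by_contra hpD
        have := H1 p hpp hp3 hpD (q i) (hq i) (by omega) (hdv i)
        omega
      obtain ⟨j, rfl⟩ := hmem p hpp hpD
      refine Finset.mem_image_of_mem q (Finset.mem_filter.2 ⟨Finset.mem_univ _, ?_⟩)
      exact hmono.lt_iff_lt.1 (by omega)
    have h1 := (Finset.card_le_card hsub).trans Finset.card_image_le
    have h2 : (Finset.univ.filter (fun j => j < i)).card = (i : ℕ) := by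
      rw [Finset.filter_gt_eq_Iio, Fin.card_Iio]
    omega
  obtain ⟨n, hn⟩ := i
  have nd2 : ∀ p : ℕ, p.Prime → 7 ≤ p → p < l → p.Prime ∧ p ∣ D ∧ 5 ≤ p := fun p h1 h2 h3 =>
    ⟨h1, hmin p h1 h2 h3, by omega⟩
  have nq : ∀ j : Fin s, 5 ≤ q j → (q j).Prime ∧ q j ∣ D ∧ 5 ≤ q j := fun j h =>
    ⟨hq j, hdv j, h⟩
  by_contra hcon
  push Not at hcon
  have gap : ∀ (x a b : ℕ), x.Prime → a < x → (∀ y, a < y → y < b → ¬ y.Prime) → b ≤ x := by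
    intro x a b hx hax hb
    by_contra h
    exact hb x hax (by omega) hx
  -- products of consecutive prime factors
  have HQ : ∀ (m l0 e0 Q0 : ℕ) (hm : m < s), 2 ≤ m → l ≤ l0 → Q0 ≤ q ⟨m, hm⟩ →
      e0 ≤ (List.ofFn (fun j : Fin (m - 1) => q ⟨j + 2, by omega⟩)).prod →
      4 * l0 ^ 4 < e0 → 64 * l0 ^ 6 < 27 * (Q0 * e0) → False := by
    intro m l0 e0 Q0 hm hm2 hll hQ0 he0
    refine HL l hl hl7 hlD _ l0 e0 (q ⟨m, hm⟩) Q0 hll ?_ ?_ ?_ hQ0 he0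
    · rw [List.nodup_ofFn]
      intro a b hab
      have := hmono.injective hab
      simp only [Fin.mk.injEq] at this
      exact Fin.ext (by omega)
    · intro p hp
      rw [List.mem_ofFn] at hp
      obtain ⟨j, rfl⟩ := hp
      refine nq _ ((b2 (by omega)).trans (hmono.monotone ?_))
      rw [Fin.le_def]
      simp
    · rw [List.mem_ofFn]
      refine ⟨⟨m - 2, by omega⟩, ?_⟩
      congr 2
      simp only
      omega
  have hn9 : n < 9 := by
    by_contra h9
    push Not at h9
    refine HQ 9 42 (5 * (7 * (11 * (13 * (17 * (19 * (23 * 29))))))) 29 (by omega) (by norm_num)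
      (by omega) (b9 _) ?_ (by norm_num) (by norm_num)
    simp only [List.ofFn_succ, List.ofFn_zero, List.prod_cons, List.prod_nil, mul_one]
    exact Nat.mul_le_mul (b2 _) (Nat.mul_le_mul (b3 _) (Nat.mul_le_mul (b4 _)
      (Nat.mul_le_mul (b5 _) (Nat.mul_le_mul (b6 _) (Nat.mul_le_mul (b7 _)
      (Nat.mul_le_mul (b8 _) (b9 _)))))))
  interval_cases n
  · have := HC {3} 89 (by simp) (by simp; norm_num) (by norm_num)
    simp at hcon
    omega
  · have := HC {3, 5} 257 (by simp) (by simp; norm_num) (by norm_num)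
    simp at hcon
    omega
  · have := HC {3, 5, 7} 733 (by simp) (by simp; norm_num) (by norm_num)
    simp at hcon
    omega
  · have := HC {3, 5, 7, 11} 1063 (by simp) (by simp; norm_num) (by norm_num)
    simp at hcon
    omega
  · have := HC {3, 5, 7, 11, 13} 1033 (by simp) (by simp; norm_num) (by norm_num)
    simp at hcon
    omega
  · have hQ : 613 ≤ q ⟨5, hn⟩ := gap _ 607 613 (hq _) (by simpa using hcon)
      (by intro x h1 h2; interval_cases x <;> norm_num)
    rcases Nat.lt_or_ge 13 l with h13 | h13
    · rcases Nat.lt_or_ge 19 l with h19 | h19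
      · refine HL l hl hl7 hlD [7, 11, 13, 17, 19, q ⟨5, hn⟩] 42 (323323 * 613) (q ⟨5, hn⟩) 613
          (by omega) ?_ ?_ (by simp) hQ ?_ (by norm_num) (by norm_num)
        · simp; omega
        · intro p hp
          simp only [List.mem_cons, List.not_mem_nil, or_false] at hp
          rcases hp with rfl | rfl | rfl | rfl | rfl | rfl
          · exact nd2 _ (by norm_num) (by norm_num) (by omega)
          · exact nd2 _ (by norm_num) (by norm_num) (by omega)
          · exact nd2 _ (by norm_num) (by norm_num) (by omega)
          · exact nd2 _ (by norm_num) (by norm_num) (by omega)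
          · exact nd2 _ (by norm_num) (by norm_num) (by omega)
          · exact nq _ (by omega)
        · simp; omega
      · refine HL l hl hl7 hlD [7, 11, 13, q ⟨5, hn⟩] 19 (1001 * 613) (q ⟨5, hn⟩) 613
          (by omega) ?_ ?_ (by simp) hQ ?_ (by norm_num) (by norm_num)
        · simp; omega
        · intro p hp
          simp only [List.mem_cons, List.not_mem_nil, or_false] at hp
          rcases hp with rfl | rfl | rfl | rfl
          · exact nd2 _ (by norm_num) (by norm_num) (by omega)
          · exact nd2 _ (by norm_num) (by norm_num) (by omega)
          · exact nd2 _ (by norm_num) (by norm_num) (by omega)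
          · exact nq _ (by omega)
        · simp; omega
    · refine HQ 5 13 (5 * (7 * (11 * 613))) 613 hn (by norm_num) h13 hQ ?_
        (by norm_num) (by norm_num)
      simp only [List.ofFn_succ, List.ofFn_zero, List.prod_cons, List.prod_nil, mul_one]
      exact Nat.mul_le_mul (b2 _) (Nat.mul_le_mul (b3 _) (Nat.mul_le_mul (b4 _) hQ))
  · have hQ : 307 ≤ q ⟨6, hn⟩ := gap _ 293 307 (hq _) (by simpa using hcon)
      (by intro x h1 h2; interval_cases x <;> norm_num)
    rcases Nat.lt_or_ge 23 l with h23 | h23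
    · refine HL l hl hl7 hlD [7, 11, 13, 17, 19, 23, q ⟨6, hn⟩] 42 (7436429 * 307) (q ⟨6, hn⟩) 307
        (by omega) ?_ ?_ (by simp) hQ ?_ (by norm_num) (by norm_num)
      · simp; omega
      · intro p hp
        simp only [List.mem_cons, List.not_mem_nil, or_false] at hp
        rcases hp with rfl | rfl | rfl | rfl | rfl | rfl | rfl
        · exact nd2 _ (by norm_num) (by norm_num) (by omega)
        · exact nd2 _ (by norm_num) (by norm_num) (by omega)
        · exact nd2 _ (by norm_num) (by norm_num) (by omega)
        · exact nd2 _ (by norm_num) (by norm_num) (by omega)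
        · exact nd2 _ (by norm_num) (by norm_num) (by omega)
        · exact nd2 _ (by norm_num) (by norm_num) (by omega)
        · exact nq _ (by omega)
      · simp; omega
    · refine HQ 6 23 (5 * (7 * (11 * (13 * 307)))) 307 hn (by norm_num) h23 hQ ?_
        (by norm_num) (by norm_num)
      simp only [List.ofFn_succ, List.ofFn_zero, List.prod_cons, List.prod_nil, mul_one]
      exact Nat.mul_le_mul (b2 _) (Nat.mul_le_mul (b3 _) (Nat.mul_le_mul (b4 _)
        (Nat.mul_le_mul (b5 _) hQ)))
  · have hQ : 127 ≤ q ⟨7, hn⟩ := gap _ 113 127 (hq _) (by simpa using hcon)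
      (by intro x h1 h2; interval_cases x <;> norm_num)
    rcases Nat.lt_or_ge 23 l with h23 | h23
    · refine HL l hl hl7 hlD [7, 11, 13, 17, 19, 23, q ⟨7, hn⟩] 42 (7436429 * 127) (q ⟨7, hn⟩) 127
        (by omega) ?_ ?_ (by simp) hQ ?_ (by norm_num) (by norm_num)
      · simp; omega
      · intro p hp
        simp only [List.mem_cons, List.not_mem_nil, or_false] at hp
        rcases hp with rfl | rfl | rfl | rfl | rfl | rfl | rfl
        · exact nd2 _ (by norm_num) (by norm_num) (by omega)
        · exact nd2 _ (by norm_num) (by norm_num) (by omega)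
        · exact nd2 _ (by norm_num) (by norm_num) (by omega)
        · exact nd2 _ (by norm_num) (by norm_num) (by omega)
        · exact nd2 _ (by norm_num) (by norm_num) (by omega)
        · exact nd2 _ (by norm_num) (by norm_num) (by omega)
        · exact nq _ (by omega)
      · simp; omega
    · refine HQ 7 23 (5 * (7 * (11 * (13 * (17 * 127))))) 127 hn (by norm_num) h23 hQ ?_
        (by norm_num) (by norm_num)
      simp only [List.ofFn_succ, List.ofFn_zero, List.prod_cons, List.prod_nil, mul_one]
      exact Nat.mul_le_mul (b2 _) (Nat.mul_le_mul (b3 _) (Nat.mul_le_mul (b4 _)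
        (Nat.mul_le_mul (b5 _) (Nat.mul_le_mul (b6 _) hQ))))
  · have hQ : 41 ≤ q ⟨8, hn⟩ := gap _ 37 41 (hq _) (by simpa using hcon)
      (by intro x h1 h2; interval_cases x <;> norm_num)
    rcases Nat.lt_or_ge 31 l with h31 | h31
    · refine HL l hl hl7 hlD [7, 11, 13, 17, 19, 23, 29, 31] 42 (7436429 * 29 * 31) 31 31
        (by omega) (by simp) ?_ (by simp) le_rfl (by simp) (by norm_num) (by norm_num)
      intro p hp
      have hp' : p.Prime ∧ 7 ≤ p ∧ p < 32 := by
        simp only [List.mem_cons, List.not_mem_nil, or_false] at hp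
        rcases hp with rfl | rfl | rfl | rfl | rfl | rfl | rfl | rfl <;> norm_num
      exact nd2 p hp'.1 hp'.2.1 (by omega)
    · refine HQ 8 31 (5 * (7 * (11 * (13 * (17 * (19 * 41)))))) 41 hn (by norm_num) h31 hQ ?_
        (by norm_num) (by norm_num)
      simp only [List.ofFn_succ, List.ofFn_zero, List.prod_cons, List.prod_nil, mul_one]
      exact Nat.mul_le_mul (b2 _) (Nat.mul_le_mul (b3 _) (Nat.mul_le_mul (b4 _)
        (Nat.mul_le_mul (b5 _) (Nat.mul_le_mul (b6 _) (Nat.mul_le_mul (b7 _) hQ)))))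

/-- Theorem 3.12(a): bounds on the ordered prime factors `q₁ < … < q_s` of the determinant
of a strongly square free, totally-reflective, positive definite ternary lattice. -/
theorem ssf_totally_reflective_dim3_prime_bounds
    (G : Matrix (Fin 3) (Fin 3) ℤ) (hsymm : G.IsSymm) (hpos : PosDefM G)
    (hssf : StronglySquareFreeM G) (htr : TotallyReflectiveM G)
    (s : ℕ) (q : Fin s → ℕ) (hq : ∀ i, (q i).Prime) (hmono : StrictMono q)
    (hdet : G.det = ∏ i, (q i : ℤ)) :
    ∀ i : Fin s, q i ≤ [89, 257, 733, 1063, 1033, 607, 293, 113, 37].getD (i : ℕ) 0 := by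
  obtain ⟨D, hDdef⟩ : ∃ D : ℕ, D = ∏ i, q i := ⟨_, rfl⟩
  have hGD : G.det = (D : ℤ) := by rw [hdet, hDdef]; push_cast; rfl
  have hD0 : 0 < D := by rw [hDdef]; exact Finset.prod_pos fun i _ => (hq i).pos
  have hD : 0 < G.det := by rw [hGD]; exact_mod_cast hD0
  have hsfD : Squarefree D := by
    rw [hDdef]
    refine Finset.squarefree_prod_of_pairwise_isCoprime ?_ (fun i _ => (hq i).squarefree)
    intro i _ j _ hij
    refine Nat.coprime_iff_isRelPrime.1 ?_
    exact (Nat.coprime_primes (hq i) (hq j)).2 (fun h => hij (hmono.injective h))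
  have hsf : Squarefree G.det := by
    rw [hGD]; exact Int.squarefree_natCast.2 hsfD
  refine fun i => numerics D hD0 ?_ ?_ s q hq hmono ?_ ?_ i
  · intro l hl hl3 hlD Q hQ hQ5 hQD
    have := boundC1 hsymm hpos hsf hD htr l hl hl3 (by rw [hGD]; exact_mod_cast hlD)
      (Q := (Q : ℤ)) (Nat.prime_iff_prime_int.1 hQ) (by exact_mod_cast hQ5)
      (by rw [hGD]; exact_mod_cast hQD)
    exact_mod_cast this
  · intro l hl hl7 hlD S hS Q hQS
    have hSD : ∏ p ∈ S, p ∣ D := Finset.prod_primes_dvd D (fun p hp => (hS p hp).1.prime)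
      (fun p hp => (hS p hp).2.1)
    have := boundC2 hsymm hpos hsf hD htr l hl hl7 (by rw [hGD]; exact_mod_cast hlD)
      (Q := (Q : ℤ)) (E := ((∏ p ∈ S, p : ℕ) : ℤ)) (Nat.prime_iff_prime_int.1 (hS Q hQS).1)
      (by exact_mod_cast Finset.prod_pos fun p hp => (hS p hp).1.pos)
      (by exact_mod_cast Finset.dvd_prod_of_mem (fun p => p) hQS)
      (by exact_mod_cast (hS Q hQS).1.pos) (by rw [hGD]; exact_mod_cast hSD)
      (by
        intro p hp hp0 hpE
        lift p to ℕ using hp0.le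
        have hpn := Nat.prime_iff_prime_int.2 hp
        have hpE' : p ∣ ∏ x ∈ S, x := by exact_mod_cast hpE
        obtain ⟨x, hx, hpx⟩ := (hpn.prime.dvd_finsetProd_iff _).1 hpE'
        have := (Nat.prime_dvd_prime_iff_eq hpn (hS x hx).1).1 hpx
        subst this
        exact_mod_cast (hS p hx).2.2)
    exact_mod_cast this
  · intro i
    rw [hDdef]
    exact Finset.dvd_prod_of_mem q (Finset.mem_univ i)
  · intro p hp hpD
    rw [hDdef] at hpD
    obtain ⟨i, _, hpi⟩ := (hp.prime.dvd_finsetProd_iff _).1 hpD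
    exact ⟨i, ((Nat.prime_dvd_prime_iff_eq hp (hq i)).1 hpi).symm⟩
end

section
/- Let (V, b) be a finite-dimensional positive definite bilinear space over ℚ, let L ⊆ V be an integral ℤ-lattice of full rank, let p be a prime, let L^# := {v ∈ V : b(v, L) ⊆ ℤ}, and let E_p(L) := L + ((1/p)·L ∩ p·L^#) be the Watson transformation of L at p. Then E_p(L) is an integral ℤ-lattice containing L, the Weyl groups satisfy W(L) ⊆ W(E_p(L)), and consequently if L is reflective then E_p(L) is reflective. -/
open Matrix

variable {V : Type} [AddCommGroup V] [Module ℚ V]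

/-- The lattice `L` is integral w.r.t. the bilinear form `β`. -/
def IsIntegralLat (β : V →ₗ[ℚ] V →ₗ[ℚ] ℚ) (L : Submodule ℤ V) : Prop :=
  ∀ x ∈ L, ∀ y ∈ L, ∃ c : ℤ, β x y = (c : ℚ)

/-- The dual lattice `L^# = {v ∈ V | β(v, L) ⊆ ℤ}`. -/
def dualLat (β : V →ₗ[ℚ] V →ₗ[ℚ] ℚ) (L : Submodule ℤ V) : Submodule ℤ V where
  carrier := {v | ∀ x ∈ L, ∃ c : ℤ, β v x = (c : ℚ)}
  zero_mem' := by
    intro x _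
    exact ⟨0, by simp⟩
  add_mem' := by
    intro v w hv hw x hx
    obtain ⟨c, hc⟩ := hv x hx
    obtain ⟨e, he⟩ := hw x hx
    refine ⟨c + e, ?_⟩
    rw [map_add, LinearMap.add_apply, hc, he]
    push_cast
    ring
  smul_mem' := by
    intro c v hv x hx
    obtain ⟨e, he⟩ := hv x hx
    refine ⟨c * e, ?_⟩
    have h1 : β (c • v) = c • β v := map_zsmul β c v
    rw [h1, LinearMap.smul_apply, he, zsmul_eq_mul]
    push_cast
    ring

/-- The image `c·L` of a lattice under scaling by a rational number `c`. -/
def scaleLat (c : ℚ) (L : Submodule ℤ V) : Submodule ℤ V :=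
  L.map ((c • (LinearMap.id : V →ₗ[ℚ] V)).restrictScalars ℤ)

/-- `v` is a root of the lattice `M` w.r.t. the form `β`: `v` is a nonzero primitive vector
of `M` whose reflection `x ↦ x − (2·β(x,v)/β(v,v))·v` maps `M` into `M`. -/
def IsRootB (β : V →ₗ[ℚ] V →ₗ[ℚ] ℚ) (M : Submodule ℤ V) (v : V) : Prop :=
  v ∈ M ∧ v ≠ 0 ∧ (∀ c : ℤ, 1 < c → ¬∃ w ∈ M, c • w = v) ∧
    ∀ x ∈ M, x - (2 * β x v / β v v) • v ∈ M

/-- `M` is reflective: its roots span a sublattice of full rank, i.e. they span `V`. -/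
def ReflectiveB (β : V →ₗ[ℚ] V →ₗ[ℚ] ℚ) (M : Submodule ℤ V) : Prop :=
  Submodule.span ℚ {v : V | IsRootB β M v} = ⊤

/-- The Watson transformation `E_p(L) = L + ((1/p)·L ∩ p·L^#)` at the prime `p`. -/
def EpLat (β : V →ₗ[ℚ] V →ₗ[ℚ] ℚ) (L : Submodule ℤ V) (p : ℕ) : Submodule ℤ V :=
  L ⊔ (scaleLat (1 / (p : ℚ)) L ⊓ scaleLat (p : ℚ) (dualLat β L))

/-- The Weyl group of `M`: the subgroup of `GL(V)` generated by the reflections in the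
roots of `M`. -/
def WeylB (β : V →ₗ[ℚ] V →ₗ[ℚ] ℚ) (M : Submodule ℤ V) : Subgroup (V ≃ₗ[ℚ] V) :=
  Subgroup.closure
    {g : V ≃ₗ[ℚ] V | ∃ v, IsRootB β M v ∧ ∀ x : V, g x = x - (2 * β x v / β v v) • v}

/-- Descent to a primitive vector in an integral positive definite lattice. -/
theorem exists_primitive_aux (β : V →ₗ[ℚ] V →ₗ[ℚ] ℚ)
    (hpos : ∀ x : V, x ≠ 0 → 0 < β x x) (M : Submodule ℤ V) (hM : IsIntegralLat β M) :
    ∀ (k : ℕ) (u : V), u ∈ M → u ≠ 0 → β u u = (k : ℚ) →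
      ∃ w ∈ M, w ≠ 0 ∧ (∀ c : ℤ, 1 < c → ¬∃ y ∈ M, c • y = w) ∧
        ∃ n : ℚ, n ≠ 0 ∧ u = n • w := by
  intro k
  induction k using Nat.strong_induction_on with
  | _ k ih =>
    intro u hu hu0 hk
    by_cases hprim : ∀ c : ℤ, 1 < c → ¬∃ y ∈ M, c • y = u
    · exact ⟨u, hu, hu0, hprim, 1, one_ne_zero, (one_smul ℚ u).symm⟩
    · push Not at hprim
      obtain ⟨c, hc, y, hy, hcy⟩ := hprim
      have hy0 : y ≠ 0 := by
        rintro rfl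
        exact hu0 (by rw [← hcy, smul_zero])
      have hcyq : u = (c : ℚ) • y := by rw [← hcy, Int.cast_smul_eq_zsmul]
      obtain ⟨e, he⟩ := hM y hy y hy
      have hepos := hpos y hy0
      have hkk : (k : ℚ) = c * (c * β y y) := by
        rw [← hk, hcyq]
        simp
      have hcq : (1 : ℚ) < c := by exact_mod_cast hc
      have hlt : β y y < k := by
        rw [hkk]
        have h1 : β y y < c * β y y := by nlinarith
        nlinarith
      have he0 : 0 ≤ e := by
        rw [he] at hepos
        exact_mod_cast hepos.le
      lift e to ℕ using he0
      have hek : e < k := by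
        rw [he] at hlt
        exact_mod_cast hlt
      obtain ⟨w, hw, hw0, hwp, n, hn, hyn⟩ := ih e hek y hy hy0 (by simpa using he)
      refine ⟨w, hw, hw0, hwp, c * n, mul_ne_zero (by positivity) hn, ?_⟩
      rw [hcyq, hyn, smul_smul]

/-- The reflection only depends on the line of the vector. -/
theorem refl_smul_aux (β : V →ₗ[ℚ] V →ₗ[ℚ] ℚ) (w x : V) (hw : β w w ≠ 0) (n : ℚ)
    (hn : n ≠ 0) :
    (2 * β x (n • w) / β (n • w) (n • w)) • (n • w) = (2 * β x w / β w w) • w := by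
  rw [smul_smul]
  congr 1
  simp only [map_smul, LinearMap.smul_apply, smul_eq_mul]
  field_simp

theorem mem_scaleLat_aux (c : ℚ) (L : Submodule ℤ V) (x : V) :
    x ∈ scaleLat c L ↔ ∃ y ∈ L, c • y = x := by
  simp [scaleLat, Submodule.mem_map]

/-- The Watson transform is integral. -/
theorem EpLat_integral_aux (β : V →ₗ[ℚ] V →ₗ[ℚ] ℚ) (hsymm : ∀ x y, β x y = β y x)
    (L : Submodule ℤ V) (hint : IsIntegralLat β L) (p : ℕ) (hp : p.Prime) :
    IsIntegralLat β (EpLat β L p) := by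
  have hp0 : (p : ℚ) ≠ 0 := by exact_mod_cast hp.ne_zero
  have hLN : ∀ x ∈ L, ∀ d ∈ dualLat β L, ∃ c : ℤ, β ((p : ℚ) • d) x = c := by
    intro x hx d hd
    obtain ⟨c, hc⟩ := hd x hx
    exact ⟨p * c, by simp [hc]⟩
  intro x hx y hy
  obtain ⟨a, ha, m, hm, rfl⟩ := Submodule.mem_sup.1 hx
  obtain ⟨b, hb, n, hn, rfl⟩ := Submodule.mem_sup.1 hy
  obtain ⟨hm1, hm2⟩ := Submodule.mem_inf.1 hm
  obtain ⟨hn1, hn2⟩ := Submodule.mem_inf.1 hn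
  obtain ⟨d, hd, hdm⟩ := (mem_scaleLat_aux _ _ _).1 hm2
  obtain ⟨e, he, hen⟩ := (mem_scaleLat_aux _ _ _).1 hn2
  obtain ⟨l, hl, hln⟩ := (mem_scaleLat_aux _ _ _).1 hn1
  obtain ⟨c1, h1⟩ := hint a ha b hb
  obtain ⟨c2, h2⟩ := hLN a ha e he
  obtain ⟨c3, h3⟩ := hLN b hb d hd
  obtain ⟨c4, h4⟩ := hd l hl
  have h5 : β m n = c4 := by
    rw [← hdm, ← hln, ← h4]
    simp only [map_smul, LinearMap.smul_apply, smul_eq_mul]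
    field_simp
  refine ⟨c1 + c2 + c3 + c4, ?_⟩
  rw [hen] at h2
  rw [hdm] at h3
  simp only [map_add, LinearMap.add_apply, h1, h3, h5, hsymm a n, h2]
  push_cast
  ring

/-- A reflection preserving `L` preserves the Watson transform. -/
theorem EpLat_stable_aux (β : V →ₗ[ℚ] V →ₗ[ℚ] ℚ) (hsymm : ∀ x y, β x y = β y x)
    (L : Submodule ℤ V) (p : ℕ) (v : V)
    (hv : ∀ x ∈ L, x - (2 * β x v / β v v) • v ∈ L) :
    ∀ x ∈ EpLat β L p, x - (2 * β x v / β v v) • v ∈ EpLat β L p := by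
  have hdual : ∀ d ∈ dualLat β L, d - (2 * β d v / β v v) • v ∈ dualLat β L := by
    intro d hd x hx
    obtain ⟨c, hc⟩ := hd _ (hv x hx)
    refine ⟨c, ?_⟩
    rw [← hc]
    simp only [map_sub, map_smul, LinearMap.sub_apply, LinearMap.smul_apply, smul_eq_mul]
    rw [hsymm v x]
    ring
  have hscale : ∀ (c : ℚ) (K : Submodule ℤ V),
      (∀ x ∈ K, x - (2 * β x v / β v v) • v ∈ K) →
      ∀ x ∈ scaleLat c K, x - (2 * β x v / β v v) • v ∈ scaleLat c K := by
    intro c K hK x hx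
    obtain ⟨y, hy, rfl⟩ := (mem_scaleLat_aux _ _ _).1 hx
    refine (mem_scaleLat_aux _ _ _).2 ⟨_, hK y hy, ?_⟩
    rw [smul_sub, smul_smul]
    congr 2
    simp only [map_smul, LinearMap.smul_apply, smul_eq_mul]
    ring
  intro x hx
  obtain ⟨a, ha, m, hm, rfl⟩ := Submodule.mem_sup.1 hx
  obtain ⟨hm1, hm2⟩ := Submodule.mem_inf.1 hm
  refine Submodule.mem_sup.2 ⟨_, hv a ha, _,
    Submodule.mem_inf.2 ⟨hscale _ _ hv m hm1, hscale _ _ hdual m hm2⟩, ?_⟩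
  rw [map_add, LinearMap.add_apply, mul_add, add_div, add_smul]
  abel

/-- The Watson transformation `E_p(L) = L + ((1/p)·L ∩ p·L^#)` of an integral lattice `L`
of full rank in a positive definite bilinear space is an integral lattice containing `L`,
its Weyl group contains the Weyl group of `L`, and consequently it is reflective whenever
`L` is reflective (Lemma 4.5). -/
theorem watson_transformation_weyl (V : Type) [AddCommGroup V] [Module ℚ V]
    [FiniteDimensional ℚ V]
    (β : V →ₗ[ℚ] V →ₗ[ℚ] ℚ) (hsymm : ∀ x y, β x y = β y x)
    (hpos : ∀ x : V, x ≠ 0 → 0 < β x x)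
    (L : Submodule ℤ V) (hfg : L.FG) (hspan : Submodule.span ℚ (L : Set V) = ⊤)
    (hint : IsIntegralLat β L) (p : ℕ) (hp : p.Prime) :
    IsIntegralLat β (EpLat β L p) ∧ L ≤ EpLat β L p ∧
      WeylB β L ≤ WeylB β (EpLat β L p) ∧
      (ReflectiveB β L → ReflectiveB β (EpLat β L p)) := by
  have hE := EpLat_integral_aux β hsymm L hint p hp
  have hLE : L ≤ EpLat β L p := le_sup_left
  have key : ∀ v, IsRootB β L v → ∃ w, IsRootB β (EpLat β L p) w ∧
      ∃ n : ℚ, n ≠ 0 ∧ v = n • w := by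
    rintro v ⟨hvL, hv0, -, hvs⟩
    obtain ⟨e, he⟩ := hint v hvL v hvL
    have he0 : 0 ≤ e := by
      have h := (hpos v hv0).le
      rw [he] at h
      exact_mod_cast h
    lift e to ℕ using he0
    obtain ⟨w, hw, hw0, hwp, n, hn, rfl⟩ :=
      exists_primitive_aux β hpos _ hE e v (hLE hvL) hv0 (by simpa using he)
    refine ⟨w, ⟨hw, hw0, hwp, ?_⟩, n, hn, rfl⟩
    intro x hx
    rw [← refl_smul_aux β w x (hpos w hw0).ne' n hn]
    exact EpLat_stable_aux β hsymm L p _ hvs x hx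
  refine ⟨hE, hLE, ?_, ?_⟩
  · refine Subgroup.closure_mono ?_
    rintro g ⟨v, hv, hg⟩
    obtain ⟨w, hw, n, hn, rfl⟩ := key v hv
    refine ⟨w, hw, fun x => ?_⟩
    rw [hg x, refl_smul_aux β w x (hpos w hw.2.1).ne' n hn]
  · intro hL
    refine top_le_iff.1 ?_
    rw [← (show Submodule.span ℚ {v : V | IsRootB β L v} = ⊤ from hL)]
    refine Submodule.span_le.2 ?_
    intro v hv
    obtain ⟨w, hw, n, hn, rfl⟩ := key v hv
    exact Submodule.smul_mem _ n (Submodule.subset_span hw)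
end
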